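/- Fix one of the two signs ± and let γ ∈ ℕ² be a multi-index. There exists a constant C > 0 such that for every Schwartz function f on ℝ², every real t ≠ 0, every μ ∈ (0,1] and every ε ∈ (0,1], the Fourier multiplier with symbol e^{± i (t/ε) |ξ| (1 + μ|ξ|²/3)^{-1/2}} (iξ)^γ/|ξ|^{|γ|} satisfies ‖e^{± i (t/ε) |D|/√(1+μ|D|²/3)} (∇^γ/|D|^{|γ|}) f‖_{L^∞(ℝ²)} ≤ C μ^{-1/2} (ε/|t|) ‖(1 + μ|D|²)² f‖_{L¹(ℝ²)}. -/

import Mathlib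

open MeasureTheory Real Complex
open scoped ENNReal InnerProductSpace

/-- Fourier transform with the convention `f̂(ξ) = (2π)^{-n/2} ∫ e^{-i x·ξ} f(x) dx`. -/
noncomputable def ft {n : ℕ} (f : EuclideanSpace ℝ (Fin n) → ℂ) (ξ : EuclideanSpace ℝ (Fin n)) : ℂ :=
  (((2 * π) ^ (-(n : ℝ) / 2) : ℝ) : ℂ) *
    ∫ x : EuclideanSpace ℝ (Fin n), Complex.exp (-Complex.I * (⟪x, ξ⟫_ℝ : ℂ)) * f x

/-- Fourier multiplier `m(D) f (x) = (2π)^{-n/2} ∫ e^{i x·ξ} m(ξ) f̂(ξ) dξ`. -/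
noncomputable def fmult {n : ℕ} (m : EuclideanSpace ℝ (Fin n) → ℂ)
    (f : EuclideanSpace ℝ (Fin n) → ℂ) (x : EuclideanSpace ℝ (Fin n)) : ℂ :=
  (((2 * π) ^ (-(n : ℝ) / 2) : ℝ) : ℂ) *
    ∫ ξ : EuclideanSpace ℝ (Fin n), Complex.exp (Complex.I * (⟪x, ξ⟫_ℝ : ℂ)) * m ξ * ft f ξ

/-- Symbol `e^{σ i τ |ξ| (1 + μ|ξ|²/3)^{-1/2}}` of the free propagator of the linearized
2D classical Boussinesq system (`σ = ±1`). -/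
noncomputable def prop2 (σ τ μ : ℝ) (ξ : EuclideanSpace ℝ (Fin 2)) : ℂ :=
  Complex.exp (Complex.I * ((σ * τ * ‖ξ‖ / Real.sqrt (1 + μ * ‖ξ‖ ^ 2 / 3) : ℝ) : ℂ))

/-- Symbol `(iξ)^γ / |ξ|^{|γ|}` of the Riesz-type multiplier `∇^γ/|D|^{|γ|}`
(extended by `0` at `ξ = 0`). -/
noncomputable def rieszSym (γ : Fin 2 → ℕ) (ξ : EuclideanSpace ℝ (Fin 2)) : ℂ :=
  (∏ i, (Complex.I * (ξ i : ℂ)) ^ γ i) / ((‖ξ‖ ^ (∑ i, γ i) : ℝ) : ℂ)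

/-- Integration by parts for an oscillatory integral. -/
lemma osc_H {ψ ψ' : ℝ → ℝ} {H H' : ℝ → ℂ} {a b : ℝ} (hab : a ≤ b)
    (hψ : ∀ x, HasDerivAt ψ (ψ' x) x) (hψc : Continuous ψ')
    (hH : ∀ x ∈ Set.Icc a b, HasDerivAt H (H' x) x) (hHc : ContinuousOn H' (Set.Icc a b)) :
    ‖∫ x in a..b, cexp (I * (ψ x : ℂ)) * (ψ' x : ℂ) * H x‖ ≤ ‖H a‖ + ‖H b‖ + ∫ x in a..b, ‖H' x‖ := by
  have hE : ∀ x, HasDerivAt (fun x => -I * cexp (I * (ψ x : ℂ))) (cexp (I * (ψ x : ℂ)) * (ψ' x : ℂ)) x := by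
    intro x
    have h1 : HasDerivAt (fun x => I * (ψ x : ℂ)) (I * (ψ' x : ℂ)) x :=
      ((hψ x).ofReal_comp).const_mul I
    have h2 := (h1.cexp).const_mul (-I)
    refine h2.congr_deriv ?_
    linear_combination (-(cexp (I * (ψ x : ℂ)) * (ψ' x : ℂ))) * I_mul_I
  have hψcont : Continuous ψ := continuous_iff_continuousAt.2 fun x => (hψ x).continuousAt
  have hEc : Continuous (fun x => cexp (I * (ψ x : ℂ)) * (ψ' x : ℂ)) := by fun_prop
  have key := intervalIntegral.integral_mul_deriv_eq_deriv_mul (a := a) (b := b) (u := H) (u' := H')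
    (v := fun x => -I * cexp (I * (ψ x : ℂ))) (v' := fun x => cexp (I * (ψ x : ℂ)) * (ψ' x : ℂ))
    (fun x hx => hH x (by rwa [Set.uIcc_of_le hab] at hx)) (fun x _ => hE x)
    (ContinuousOn.intervalIntegrable (by rwa [Set.uIcc_of_le hab]))
    (hEc.intervalIntegrable _ _)
  have hn : ∀ x, ‖-I * cexp (I * (ψ x : ℂ))‖ = 1 := by
    intro x; rw [norm_mul, norm_exp]; simp
  have e : (∫ x in a..b, cexp (I * (ψ x : ℂ)) * (ψ' x : ℂ) * H x)
      = ∫ x in a..b, H x * (cexp (I * (ψ x : ℂ)) * (ψ' x : ℂ)) := by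
    congr 1; ext x; ring
  rw [e, key]
  have h3 : ‖∫ x in a..b, H' x * (-I * cexp (I * (ψ x : ℂ)))‖ ≤ ∫ x in a..b, ‖H' x‖ := by
    refine (intervalIntegral.norm_integral_le_integral_norm hab).trans (le_of_eq ?_)
    congr 1; ext x; rw [norm_mul, hn, mul_one]
  calc _ ≤ ‖H b * (-I * cexp (I * (ψ b : ℂ)))‖ + ‖H a * (-I * cexp (I * (ψ a : ℂ)))‖
        + ‖∫ x in a..b, H' x * (-I * cexp (I * (ψ x : ℂ)))‖ :=
        (norm_sub_le _ _).trans (add_le_add_left (norm_sub_le _ _) _)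
    _ ≤ _ := by
        rw [norm_mul, norm_mul (H a), hn, hn]; linarith

/-- Integration by parts with a monotone factor. -/
lemma osc_L {ψ ψ' : ℝ → ℝ} {W W' : ℝ → ℂ} {Q Q' : ℝ → ℝ} {a b M S S' : ℝ} (hab : a ≤ b)
    (hψ : ∀ x, HasDerivAt ψ (ψ' x) x) (hψc : Continuous ψ')
    (hW : ∀ x, HasDerivAt W (W' x) x) (hWc : Continuous W')
    (hQ : ∀ x ∈ Set.Icc a b, HasDerivAt Q (Q' x) x) (hQc : ContinuousOn Q' (Set.Icc a b))
    (hsign : (∀ x ∈ Set.Icc a b, 0 ≤ Q' x) ∨ (∀ x ∈ Set.Icc a b, Q' x ≤ 0))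
    (hM : ∀ x ∈ Set.Icc a b, |Q x| ≤ M) (hS : ∀ x ∈ Set.Icc a b, ‖W x‖ ≤ S)
    (hS' : ∫ x in a..b, ‖W' x‖ ≤ S') :
    ‖∫ x in a..b, cexp (I * (ψ x : ℂ)) * (ψ' x : ℂ) * (W x * (Q x : ℂ))‖ ≤ M * (4 * S + S') := by
  have hWcont : Continuous W := continuous_iff_continuousAt.2 fun x => (hW x).continuousAt
  have hQcont : ContinuousOn Q (Set.Icc a b) := fun x hx => (hQ x hx).continuousAt.continuousWithinAt
  have ha : a ∈ Set.Icc a b := ⟨le_rfl, hab⟩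
  have hb : b ∈ Set.Icc a b := ⟨hab, le_rfl⟩
  have hM0 : 0 ≤ M := (abs_nonneg _).trans (hM a ha)
  have hS0 : 0 ≤ S := (norm_nonneg _).trans (hS a ha)
  have huI : Set.uIcc a b = Set.Icc a b := Set.uIcc_of_le hab
  have hQi : IntervalIntegrable Q' volume a b := ContinuousOn.intervalIntegrable (by rwa [huI])
  have hQabs : ∫ x in a..b, |Q' x| ≤ 2 * M := by
    have hft : ∫ x in a..b, Q' x = Q b - Q a :=
      intervalIntegral.integral_eq_sub_of_hasDerivAt (fun x hx => hQ x (huI ▸ hx)) hQi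
    have h1 := abs_le.1 (hM a ha)
    have h2 := abs_le.1 (hM b hb)
    rcases hsign with h | h
    · rw [intervalIntegral.integral_congr (g := Q') (fun x hx => abs_of_nonneg (h x (huI ▸ hx))), hft]
      linarith
    · rw [intervalIntegral.integral_congr (g := fun x => - Q' x)
        (fun x hx => abs_of_nonpos (h x (huI ▸ hx))), intervalIntegral.integral_neg, hft]
      linarith
  have hH : ∀ x ∈ Set.Icc a b, HasDerivAt (fun x => W x * (Q x : ℂ))
      (W' x * (Q x : ℂ) + W x * (Q' x : ℂ)) x := fun x hx => (hW x).mul (hQ x hx).ofReal_comp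
  have hc1 : ContinuousOn (fun x => (Q x : ℂ)) (Set.Icc a b) :=
    Complex.continuous_ofReal.comp_continuousOn hQcont
  have hc2 : ContinuousOn (fun x => (Q' x : ℂ)) (Set.Icc a b) :=
    Complex.continuous_ofReal.comp_continuousOn hQc
  have hHc : ContinuousOn (fun x => W' x * (Q x : ℂ) + W x * (Q' x : ℂ)) (Set.Icc a b) :=
    (hWc.continuousOn.mul hc1).add (hWcont.continuousOn.mul hc2)
  refine (osc_H hab hψ hψc hH hHc).trans ?_
  have hpt : ∀ x ∈ Set.Icc a b, ‖W x * (Q x : ℂ)‖ ≤ S * M := by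
    intro x hx
    rw [norm_mul, Complex.norm_real]
    exact mul_le_mul (hS x hx) (hM x hx) (abs_nonneg _) hS0
  have hInt : ∫ x in a..b, ‖W' x * (Q x : ℂ) + W x * (Q' x : ℂ)‖ ≤
      ∫ x in a..b, (M * ‖W' x‖ + S * |Q' x|) := by
    refine intervalIntegral.integral_mono_on hab ?_ ?_ ?_
    · exact ContinuousOn.intervalIntegrable (by rw [huI]; exact hHc.norm)
    · exact ((hWc.norm.intervalIntegrable _ _).const_mul M).add (hQi.abs.const_mul S)
    · intro x hx
      refine (norm_add_le _ _).trans (add_le_add ?_ ?_)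
      · rw [norm_mul, Complex.norm_real, mul_comm]
        exact mul_le_mul_of_nonneg_right (hM x hx) (norm_nonneg _)
      · rw [norm_mul, Complex.norm_real]
        exact mul_le_mul_of_nonneg_right (hS x hx) (norm_nonneg _)
  rw [intervalIntegral.integral_add ((hWc.norm.intervalIntegrable _ _).const_mul M) (hQi.abs.const_mul S),
    intervalIntegral.integral_const_mul, intervalIntegral.integral_const_mul] at hInt
  have h1 := hpt a ha
  have h2 := hpt b hb
  have h3 := mul_le_mul_of_nonneg_left hS' hM0
  have h4 := mul_le_mul_of_nonneg_left hQabs hS0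
  linarith

noncomputable def AA (x : ℝ) : ℝ := √(1 + x ^ 2)
noncomputable def phB (x : ℝ) : ℝ := x / AA x
noncomputable def gg (x : ℝ) : ℝ := x / (1 + 3 * x ^ 2) ^ 2
noncomputable def kk (x : ℝ) : ℝ := x * AA x ^ 3 / (1 + 3 * x ^ 2) ^ 2
noncomputable def kk' (x : ℝ) : ℝ := AA x * (1 - 5 * x ^ 2) / (1 + 3 * x ^ 2) ^ 3

lemma AA_sq (x : ℝ) : AA x ^ 2 = 1 + x ^ 2 := Real.sq_sqrt (by positivity)
lemma AA_one_le (x : ℝ) : 1 ≤ AA x := by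
  rw [AA, Real.one_le_sqrt]; nlinarith [sq_nonneg x]
lemma AA_pos (x : ℝ) : 0 < AA x := zero_lt_one.trans_le (AA_one_le x)
lemma le_AA (x : ℝ) : x ≤ AA x := Real.le_sqrt_of_sq_le (by linarith)
lemma AA_mono {x y : ℝ} (hx : 0 ≤ x) (h : x ≤ y) : AA x ≤ AA y :=
  Real.sqrt_le_sqrt (by gcongr)
lemma AA_deriv (x : ℝ) : HasDerivAt AA (x / AA x) x := by
  have h : HasDerivAt (fun x : ℝ => 1 + x ^ 2) (2 * x) x := by
    simpa using ((hasDerivAt_id x).pow 2).const_add 1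
  refine (h.sqrt (by positivity)).congr_deriv ?_
  rw [AA]
  have : √(1 + x ^ 2) ≠ 0 := by positivity
  field_simp
lemma AA_cont : Continuous AA := by unfold AA; fun_prop
lemma phB_deriv (x : ℝ) : HasDerivAt phB (1 / AA x ^ 3) x := by
  have hA := (AA_pos x).ne'
  refine ((hasDerivAt_id x).div (AA_deriv x) hA).congr_deriv ?_
  have := AA_sq x
  simp only [id]
  field_simp
  linarith
lemma kk_deriv (x : ℝ) : HasDerivAt kk (kk' x) x := by
  have h : HasDerivAt (fun x : ℝ => 1 + 3 * x ^ 2) (6 * x) x := by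
    refine ((((hasDerivAt_id x).pow 2).const_mul 3).const_add 1).congr_deriv ?_
    simp; ring
  have hA := (AA_pos x).ne'
  have h3 : (1 + 3 * x ^ 2) ≠ 0 := by positivity
  refine (((hasDerivAt_id x).mul ((AA_deriv x).pow 3)).div (h.pow 2) (pow_ne_zero 2 h3)).congr_deriv ?_
  have := AA_sq x
  simp only [kk', id, Pi.mul_apply, Pi.pow_apply]
  field_simp
  have e4 : AA x ^ 4 = (1 + x ^ 2) ^ 2 := by rw [← this]; ring
  push_cast
  norm_num
  rw [this]
  ring_nf
  rw [e4]
  ring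
lemma AA_four_le (x : ℝ) : AA x ^ 4 ≤ (1 + 3 * x ^ 2) ^ 2 := by
  have : AA x ^ 4 = (1 + x ^ 2) ^ 2 := by rw [← AA_sq]; ring
  rw [this]; gcongr; nlinarith [sq_nonneg x]
lemma gg_le {x : ℝ} (hx : 0 ≤ x) : gg x ≤ x / AA x ^ 4 := by
  have := AA_pos x
  unfold gg; gcongr; exact AA_four_le x
lemma gg_nonneg {x : ℝ} (hx : 0 ≤ x) : 0 ≤ gg x := by unfold gg; positivity
lemma kk_nonneg {x : ℝ} (hx : 0 ≤ x) : 0 ≤ kk x := by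
  have := AA_pos x
  unfold kk; positivity
lemma kk_le {x : ℝ} (hx : 0 ≤ x) : kk x ≤ x / AA x := by
  have := AA_pos x
  have e : kk x = AA x ^ 3 * gg x := by unfold kk gg; ring
  rw [e]
  calc AA x ^ 3 * gg x ≤ AA x ^ 3 * (x / AA x ^ 4) := by gcongr; exact gg_le hx
    _ = x / AA x := by field_simp
lemma kk_le_one {x : ℝ} (hx : 0 ≤ x) : kk x ≤ 1 :=
  (kk_le hx).trans ((div_le_one (AA_pos x)).2 (le_AA x))
lemma kk'_le (x : ℝ) : |kk' x| ≤ 5 / AA x ^ 3 := by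
  have hA := AA_pos x
  have h1 : |1 - 5 * x ^ 2| ≤ 5 * (1 + x ^ 2) := by
    rw [abs_le]; constructor <;> nlinarith [sq_nonneg x]
  have h6 : AA x ^ 6 ≤ (1 + 3 * x ^ 2) ^ 3 := by
    have : AA x ^ 6 = (1 + x ^ 2) ^ 3 := by rw [← AA_sq]; ring
    rw [this]; gcongr; nlinarith [sq_nonneg x]
  rw [kk', abs_div, abs_mul, abs_of_pos hA, abs_of_pos (by positivity : 0 < (1 + 3 * x ^ 2) ^ 3)]
  calc AA x * |1 - 5 * x ^ 2| / (1 + 3 * x ^ 2) ^ 3 ≤ AA x * (5 * (1 + x ^ 2)) / AA x ^ 6 := by gcongr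
    _ = 5 / AA x ^ 3 := by rw [← AA_sq]; field_simp
lemma kk'_cont : Continuous kk' := by
  unfold kk'
  exact ((AA_cont.mul (by fun_prop)).div (by fun_prop) (fun x => by positivity))

/-- Symbol-type amplitude of order `-1/2`. -/
structure Amp (a a' : ℝ → ℂ) (K : ℝ) : Prop where
  hd : ∀ ρ, HasDerivAt a (a' ρ) ρ
  hc : Continuous a'
  h0 : ∀ ρ, 0 ≤ ρ → ‖a ρ‖ ≤ K / √(1 + ρ)
  h1 : ∀ ρ, 0 ≤ ρ → ‖a' ρ‖ ≤ K / ((1 + ρ) * √(1 + ρ))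

noncomputable def WW (a : ℝ → ℂ) (R x : ℝ) : ℂ := (kk x : ℂ) * a (R * x)
noncomputable def WW' (a a' : ℝ → ℂ) (R x : ℝ) : ℂ :=
  (kk' x : ℂ) * a (R * x) + (kk x : ℂ) * (R * a' (R * x))
noncomputable def QQ (T ρ x : ℝ) : ℝ := T / (T - ρ * AA x ^ 3)
noncomputable def QQ' (T ρ x : ℝ) : ℝ := 3 * T * ρ * x * AA x / (T - ρ * AA x ^ 3) ^ 2
noncomputable def FF (a : ℝ → ℂ) (T ρ x : ℝ) : ℂ :=
  cexp (I * ((T * phB x - ρ * x : ℝ) : ℂ)) * (gg x : ℂ) * a (|ρ| * x)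

section
variable {a a' : ℝ → ℂ} {K : ℝ}

lemma Amp.cont (h : Amp a a' K) : Continuous a :=
  continuous_iff_continuousAt.2 fun x => (h.hd x).continuousAt

lemma Amp.K_nonneg (h : Amp a a' K) : 0 ≤ K := by
  have := (norm_nonneg _).trans (h.h0 0 le_rfl)
  simpa using this

lemma WW_deriv (h : Amp a a' K) (R x : ℝ) : HasDerivAt (WW a R) (WW' a a' R x) x := by
  have h1 : HasDerivAt (fun x : ℝ => R * x) R x := by simpa using (hasDerivAt_id x).const_mul R
  have h2 := (h.hd (R * x)).scomp x h1
  refine ((kk_deriv x).ofReal_comp.mul h2).congr_deriv ?_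
  simp [WW']

lemma WW'_cont (h : Amp a a' K) (R : ℝ) : Continuous (WW' a a' R) := by
  have h1 := h.cont
  have h2 := h.hc
  have h3 := kk'_cont
  have h4 : Continuous kk := continuous_iff_continuousAt.2 fun x => (kk_deriv x).continuousAt
  unfold WW'
  fun_prop

lemma QQ_deriv {T ρ x : ℝ} (h : T - ρ * AA x ^ 3 ≠ 0) : HasDerivAt (QQ T ρ) (QQ' T ρ x) x := by
  have hA := (AA_pos x).ne'
  have h1 := (((AA_deriv x).pow 3).const_mul ρ).const_sub T
  refine ((hasDerivAt_const x T).div h1 h).congr_deriv ?_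
  rw [QQ']
  simp only [Pi.pow_apply]
  field_simp
  push_cast
  ring

lemma QQ'_cont {T ρ : ℝ} {s : Set ℝ} (h : ∀ x ∈ s, T - ρ * AA x ^ 3 ≠ 0) :
    ContinuousOn (QQ' T ρ) s := by
  have := AA_cont
  unfold QQ'
  refine ContinuousOn.div (by fun_prop) (by fun_prop) (fun x hx => pow_ne_zero _ (h x hx))

lemma psi_deriv (T ρ x : ℝ) : HasDerivAt (fun x => T * phB x - ρ * x) (T / AA x ^ 3 - ρ) x := by
  have h1 : HasDerivAt (fun x : ℝ => ρ * x) ρ x := by simpa using (hasDerivAt_id x).const_mul ρ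
  refine (((phB_deriv x).const_mul T).sub h1).congr_deriv ?_
  ring

lemma psi'_cont (T ρ : ℝ) : Continuous (fun x => T / AA x ^ 3 - ρ) := by
  have := AA_cont
  exact (continuous_const.div (by fun_prop) (fun x => (pow_pos (AA_pos x) 3).ne')).sub continuous_const

lemma FF_cont (h : Amp a a' K) (T ρ : ℝ) : Continuous (FF a T ρ) := by
  have h1 := h.cont
  have h2 : Continuous phB := continuous_iff_continuousAt.2 fun x => (phB_deriv x).continuousAt
  have h3 : Continuous gg := by
    unfold gg; exact continuous_id.div (by fun_prop) (fun x => by positivity)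
  unfold FF
  fun_prop

lemma FF_eq {T ρ x : ℝ} (h : T - ρ * AA x ^ 3 ≠ 0) :
    (T : ℂ) * FF a T ρ x = cexp (I * ((T * phB x - ρ * x : ℝ) : ℂ)) * ((T / AA x ^ 3 - ρ : ℝ) : ℂ)
      * (WW a |ρ| x * (QQ T ρ x : ℂ)) := by
  have e : T * gg x = (T / AA x ^ 3 - ρ) * (kk x * QQ T ρ x) := by
    have hA := (AA_pos x).ne'
    have h' : T - AA x ^ 3 * ρ ≠ 0 := by rwa [mul_comm]
    unfold gg kk QQ
    field_simp
  have e' : (T : ℂ) * (gg x : ℂ) = ((T / AA x ^ 3 - ρ : ℝ) : ℂ) * ((kk x : ℂ) * (QQ T ρ x : ℂ)) := by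
    exact_mod_cast e
  unfold FF WW
  linear_combination (cexp (I * ((T * phB x - ρ * x : ℝ) : ℂ)) * a (|ρ| * x)) * e'

lemma norm_FF_le (h : Amp a a' K) {T ρ x D : ℝ} (hx : 0 < x) (hρ : 0 < ρ) (hD0 : 0 ≤ D)
    (hD : 1 ≤ ρ * D ^ 2) : ‖a (|ρ| * x)‖ ≤ K * D / √x ∧ ‖a' (|ρ| * x)‖ ≤ K * D / (ρ * x * √x) ∧
      ‖FF a T ρ x‖ ≤ K * D * √x / AA x ^ 4 := by
  have hK := h.K_nonneg
  rw [abs_of_pos hρ]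
  have hs : √x ≤ √(1 + ρ * x) * D := by
    rw [← Real.sqrt_sq hD0, ← Real.sqrt_mul (by positivity)]
    apply Real.sqrt_le_sqrt
    nlinarith [sq_nonneg D]
  have hsx : 0 < √x := Real.sqrt_pos.2 hx
  have h1 : K / √(1 + ρ * x) ≤ K * D / √x := by
    rw [div_le_div_iff₀ (by positivity) hsx]
    nlinarith
  have ha : ‖a (ρ * x)‖ ≤ K * D / √x := (h.h0 _ (by positivity)).trans h1
  refine ⟨ha, ?_, ?_⟩
  · refine (h.h1 _ (by positivity)).trans ?_
    calc K / ((1 + ρ * x) * √(1 + ρ * x)) = K / √(1 + ρ * x) / (1 + ρ * x) := by field_simp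
      _ ≤ (K * D / √x) / (ρ * x) := by gcongr; linarith
      _ = _ := by field_simp
  · have hA := AA_pos x
    have hg : |gg x| ≤ x / AA x ^ 4 := by rw [abs_of_nonneg (gg_nonneg hx.le)]; exact gg_le hx.le
    rw [FF, norm_mul, norm_mul, norm_exp, Complex.norm_real, Real.norm_eq_abs, abs_of_pos hρ]
    have : (I * ((T * phB x - ρ * x : ℝ) : ℂ)).re = 0 := by simp
    rw [this, Real.exp_zero, one_mul]
    calc |gg x| * ‖a (ρ * x)‖ ≤ (x / AA x ^ 4) * (K * D / √x) := by gcongr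
      _ = K * D * √x / AA x ^ 4 := by
        field_simp
        rw [Real.sq_sqrt hx.le]; ring

lemma norm_WW_le_one (h : Amp a a' K) {R x : ℝ} (hx : 0 ≤ x) (hR : 0 ≤ R) : ‖WW a R x‖ ≤ K := by
  have hK := h.K_nonneg
  have h1 : ‖a (R * x)‖ ≤ K := (h.h0 _ (by positivity)).trans
    (div_le_self hK (by rw [Real.one_le_sqrt]; nlinarith [mul_nonneg hR hx]))
  rw [WW, norm_mul, Complex.norm_real, Real.norm_eq_abs, abs_of_nonneg (kk_nonneg hx)]
  calc kk x * ‖a (R * x)‖ ≤ 1 * K := by gcongr; exact kk_le_one hx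
    _ = K := one_mul K

lemma int_WW'_le (h : Amp a a' K) {R l u : ℝ} (hl : 0 ≤ l) (hlu : l ≤ u) (hR : 0 ≤ R) :
    ∫ x in l..u, ‖WW' a a' R x‖ ≤ 10 * K := by
  have hK := h.K_nonneg
  have key := intervalIntegral.integral_le_sub_of_hasDeriv_right_of_le (a := l) (b := u)
    (g := fun x => 5 * K * Real.arctan x - 2 * K * (√(1 + R * x))⁻¹)
    (g' := fun x => 5 * K * (1 / (1 + x ^ 2)) + K * (R / ((1 + R * x) * √(1 + R * x))))
    (φ := fun x => ‖WW' a a' R x‖) hlu ?_ ?_ ?_ ?_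
  · refine key.trans ?_
    have h1 : 0 ≤ Real.arctan l := Real.arctan_nonneg.2 hl
    have h2 := (Real.arctan_lt_pi_div_two u).le
    have h3 : 0 ≤ (√(1 + R * u))⁻¹ := by positivity
    have h4 : (√(1 + R * l))⁻¹ ≤ 1 := by
      apply inv_le_one_of_one_le₀
      rw [Real.one_le_sqrt]; nlinarith [mul_nonneg hR hl]
    have h5 := Real.pi_lt_d2
    have a1 := mul_nonneg hK h1
    have a2 := mul_le_mul_of_nonneg_left h2 hK
    have a3 := mul_nonneg hK h3
    have a4 := mul_le_mul_of_nonneg_left h4 hK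
    have a5 := mul_le_mul_of_nonneg_left h5.le hK
    linarith
  · intro x hx
    have hx0 : 0 ≤ x := hl.trans hx.1
    have : √(1 + R * x) ≠ 0 := by positivity
    apply ContinuousAt.continuousWithinAt
    refine ContinuousAt.sub (by fun_prop) (ContinuousAt.mul (by fun_prop) (ContinuousAt.inv₀ (by fun_prop) this))
  · intro x hx
    have hx0 : 0 ≤ x := hl.trans hx.1.le
    have hp : 0 < 1 + R * x := by positivity
    have hsq : √(1 + R * x) ^ 2 = 1 + R * x := Real.sq_sqrt hp.le
    have h1 : HasDerivAt (fun x : ℝ => 1 + R * x) R x := by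
      simpa using ((hasDerivAt_id x).const_mul R).const_add 1
    have h2 := (h1.sqrt hp.ne').inv (by positivity)
    refine (((Real.hasDerivAt_arctan x).const_mul (5 * K)).sub (h2.const_mul (2 * K))).hasDerivWithinAt.congr_deriv ?_
    have : √(1 + R * x) ≠ 0 := by positivity
    rw [hsq]
    field_simp
    ring
  · exact (WW'_cont h R).norm.continuousOn.integrableOn_Icc
  · intro x hx
    have hx0 : 0 ≤ x := hl.trans hx.1.le
    have hA := AA_pos x
    have h1 : ‖a (R * x)‖ ≤ K := (h.h0 _ (by positivity)).trans
      (div_le_self hK (by rw [Real.one_le_sqrt]; nlinarith [mul_nonneg hR hx0]))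
    have h2 := h.h1 (R * x) (by positivity)
    have hk : |kk' x| ≤ 5 * (1 / (1 + x ^ 2)) := by
      refine (kk'_le x).trans ?_
      rw [← AA_sq, mul_one_div]
      gcongr
      · exact AA_one_le x
      · norm_num
    refine (norm_add_le _ _).trans (add_le_add ?_ ?_)
    · rw [norm_mul, Complex.norm_real, Real.norm_eq_abs]
      calc |kk' x| * ‖a (R * x)‖ ≤ 5 * (1 / (1 + x ^ 2)) * K := by gcongr
        _ = _ := by ring
    · rw [norm_mul, norm_mul, Complex.norm_real, Complex.norm_real, Real.norm_eq_abs, Real.norm_eq_abs,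
        abs_of_nonneg (kk_nonneg hx0), abs_of_nonneg hR]
      calc kk x * (R * ‖a' (R * x)‖) ≤ 1 * (R * (K / ((1 + R * x) * √(1 + R * x)))) := by
            gcongr; exact kk_le_one hx0
        _ = _ := by ring

lemma norm_WW_le (h : Amp a a' K) {ρ x D : ℝ} (hx : 0 < x) (hρ : 0 < ρ) (hD0 : 0 ≤ D)
    (hD : 1 ≤ ρ * D ^ 2) : ‖WW a |ρ| x‖ ≤ K * D * √x / AA x ∧
      ‖WW' a a' |ρ| x‖ ≤ 6 * K * D / (√x * AA x) := by
  obtain ⟨h1, h2, -⟩ := norm_FF_le h (T := 0) hx hρ hD0 hD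
  have hK := h.K_nonneg
  have hA := AA_pos x
  have hsx : 0 < √x := Real.sqrt_pos.2 hx
  have hs2 : √x ^ 2 = x := Real.sq_sqrt hx.le
  constructor
  · rw [WW, norm_mul, Complex.norm_real, Real.norm_eq_abs, abs_of_nonneg (kk_nonneg hx.le)]
    calc kk x * ‖a (|ρ| * x)‖ ≤ (x / AA x) * (K * D / √x) := by gcongr; exact kk_le hx.le
      _ = K * D * √x / AA x := by
        field_simp; rw [hs2]; ring
  · refine (norm_add_le _ _).trans ?_
    have e : 6 * K * D / (√x * AA x) = 5 / AA x * (K * D / √x) + (x / AA x) * (ρ * (K * D / (ρ * x * √x))) := by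
      field_simp; ring
    rw [e]
    refine add_le_add ?_ ?_
    · rw [norm_mul, Complex.norm_real, Real.norm_eq_abs]
      have : |kk' x| ≤ 5 / AA x := by
        refine (kk'_le x).trans ?_
        gcongr
        exact le_self_pow₀ (AA_one_le x) (by norm_num)
      gcongr
    · rw [norm_mul, norm_mul, Complex.norm_real, Complex.norm_real, Real.norm_eq_abs, Real.norm_eq_abs,
        abs_of_nonneg (kk_nonneg hx.le), abs_abs, abs_of_pos hρ]
      rw [abs_of_pos hρ] at h2
      gcongr
      exact kk_le hx.le

end

section
variable {a a' : ℝ → ℂ} {K : ℝ}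

lemma seg_L (h : Amp a a' K) {T ρ l u M S S' : ℝ} (hT : 0 < T) (hl : 0 ≤ l) (hlu : l ≤ u)
    (hne : ∀ x ∈ Set.Icc l u, T - ρ * AA x ^ 3 ≠ 0) (hM : ∀ x ∈ Set.Icc l u, |QQ T ρ x| ≤ M)
    (hS : ∀ x ∈ Set.Icc l u, ‖WW a |ρ| x‖ ≤ S) (hS' : ∫ x in l..u, ‖WW' a a' |ρ| x‖ ≤ S') :
    ‖∫ x in l..u, FF a T ρ x‖ ≤ M * (4 * S + S') / T := by
  have key := osc_L hlu (psi_deriv T ρ) (psi'_cont T ρ) (WW_deriv h |ρ|) (WW'_cont h |ρ|)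
    (fun x hx => QQ_deriv (hne x hx)) (QQ'_cont hne) ?_ hM hS hS'
  · rw [← intervalIntegral.integral_congr (f := fun x => (T : ℂ) * FF a T ρ x)
      (fun x hx => FF_eq (hne x (by rwa [Set.uIcc_of_le hlu] at hx))),
      intervalIntegral.integral_const_mul, norm_mul, Complex.norm_real, Real.norm_eq_abs,
      abs_of_pos hT] at key
    rw [le_div_iff₀ hT]; linarith
  · have hp : ∀ x ∈ Set.Icc l u, 0 ≤ 3 * T * x * AA x / (T - ρ * AA x ^ 3) ^ 2 := by
      intro x hx
      have := AA_pos x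
      have : 0 ≤ x := hl.trans hx.1
      positivity
    have e : ∀ x, QQ' T ρ x = ρ * (3 * T * x * AA x / (T - ρ * AA x ^ 3) ^ 2) := by
      intro x; unfold QQ'; ring
    rcases le_total 0 ρ with hr | hr
    · left; intro x hx; rw [e]; exact mul_nonneg hr (hp x hx)
    · right; intro x hx; rw [e]; exact mul_nonpos_of_nonpos_of_nonneg hr (hp x hx)

lemma case_good (h : Amp a a' K) {T ρ N : ℝ} (hT : 0 < T) (hρ : ρ ≤ 0) (hN : 0 ≤ N) :
    ‖∫ x in (0 : ℝ)..N, FF a T ρ x‖ ≤ 14 * K / T := by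
  have hp : ∀ x, T ≤ T - ρ * AA x ^ 3 := fun x => by
    have := mul_nonneg (neg_nonneg.2 hρ) (pow_pos (AA_pos x) 3).le
    linarith
  have := seg_L h (M := 1) (S := K) (S' := 10 * K) (ρ := ρ) hT le_rfl hN
    (fun x _ => (hT.trans_le (hp x)).ne')
    (fun x _ => by
      rw [QQ, abs_div, abs_of_pos hT, abs_of_pos (hT.trans_le (hp x)), div_le_one (hT.trans_le (hp x))]
      exact hp x)
    (fun x hx => norm_WW_le_one h hx.1 (abs_nonneg _)) (int_WW'_le h le_rfl hN (abs_nonneg _))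
  refine this.trans (le_of_eq ?_)
  ring

lemma Acube {x y : ℝ} (hx : 0 ≤ x) (hxy : x ≤ y) :
    3 / 4 * ((y ^ 2 - x ^ 2) * (AA y + AA x)) ≤ AA y ^ 3 - AA x ^ 3 := by
  have h1 := AA_mono hx hxy
  have e1 := AA_sq x
  have e2 := AA_sq y
  have e : y ^ 2 - x ^ 2 = (AA y - AA x) * (AA y + AA x) := by nlinarith
  rw [e]
  have : 0 ≤ (AA y - AA x) ^ 3 := pow_nonneg (by linarith) 3
  nlinarith

lemma Acube' {x y : ℝ} (hx : 0 ≤ x) (hxy : x ≤ y) :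
    3 / 4 * ((y ^ 2 - x ^ 2) * AA x) ≤ AA y ^ 3 - AA x ^ 3 := by
  refine le_trans ?_ (Acube hx hxy)
  have := AA_pos y
  have : 0 ≤ y ^ 2 - x ^ 2 := by nlinarith
  gcongr
  linarith

lemma Acube'' {x y : ℝ} (hx : 0 ≤ x) (hxy : x ≤ y) :
    3 / 4 * ((y ^ 2 - x ^ 2) * AA y) ≤ AA y ^ 3 - AA x ^ 3 := by
  refine le_trans ?_ (Acube hx hxy)
  have := AA_pos x
  have : 0 ≤ y ^ 2 - x ^ 2 := by nlinarith
  gcongr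
  linarith

/-- bound for `Q` to the right of the stationary point -/
lemma Q_right {T ρ x0 x q : ℝ} (hT : 0 < T) (hx0 : 0 ≤ x0) (hx : x0 ≤ x) (hq : 0 < q)
    (hqx : q ≤ x ^ 2 - x0 ^ 2) (hTρ : T ≤ ρ * AA x0 ^ 3) :
    T - ρ * AA x ^ 3 < 0 ∧ |QQ T ρ x| ≤ 4 / 3 * AA x0 ^ 2 / q := by
  have hA0 := AA_pos x0
  have hA := AA_pos x
  have hρ : 0 < ρ := by
    by_contra hc
    have := mul_nonneg (neg_nonneg.2 (not_lt.1 hc)) (pow_pos hA0 3).le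
    linarith
  have h1 := Acube' hx0 hx
  have h2 : 3 / 4 * (q * AA x0) ≤ AA x ^ 3 - AA x0 ^ 3 := le_trans (by gcongr) h1
  have h2' : 0 < q * AA x0 := by positivity
  have h3 : ρ * (3 / 4 * (q * AA x0)) ≤ ρ * (AA x ^ 3 - AA x0 ^ 3) := by gcongr
  have h4 : 0 < ρ * (q * AA x0) := by positivity
  have hneg : T - ρ * AA x ^ 3 < 0 := by nlinarith
  refine ⟨hneg, ?_⟩
  rw [QQ, abs_div, abs_of_pos hT, abs_of_neg hneg, div_le_div_iff₀ (by linarith) hq]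
  have h5 : T * q ≤ ρ * AA x0 ^ 3 * q := by gcongr
  have h6 : 3 / 4 * (ρ * q * AA x0) * (AA x0 ^ 2) ≤ (-(T - ρ * AA x ^ 3)) * AA x0 ^ 2 := by
    gcongr; nlinarith
  nlinarith

lemma Q_left {T ρ x0 x q : ℝ} (hT : 0 < T) (hx0 : 0 ≤ x) (hx : x ≤ x0) (hq : 0 < q)
    (hqx : q ≤ x0 ^ 2 - x ^ 2) (hTρ : T = ρ * AA x0 ^ 3) :
    0 < T - ρ * AA x ^ 3 ∧ |QQ T ρ x| ≤ 4 / 3 * AA x0 ^ 2 / q := by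
  have hA0 := AA_pos x0
  have hA := AA_pos x
  have hρ : 0 < ρ := by
    by_contra hc
    have := mul_nonneg (neg_nonneg.2 (not_lt.1 hc)) (pow_pos hA0 3).le
    linarith
  have h1 := Acube'' hx0 hx
  have h2 : 3 / 4 * (q * AA x0) ≤ AA x0 ^ 3 - AA x ^ 3 := le_trans (by gcongr) h1
  have h2' : 0 < q * AA x0 := by positivity
  have h3 : ρ * (3 / 4 * (q * AA x0)) ≤ ρ * (AA x0 ^ 3 - AA x ^ 3) := by gcongr
  have h4 : 0 < ρ * (q * AA x0) := by positivity
  have hneg : 0 < T - ρ * AA x ^ 3 := by nlinarith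
  refine ⟨hneg, ?_⟩
  rw [QQ, abs_div, abs_of_pos hT, abs_of_pos hneg, div_le_div_iff₀ hneg hq]
  have h6 : 3 / 4 * (ρ * q * AA x0) * (AA x0 ^ 2) ≤ (T - ρ * AA x ^ 3) * AA x0 ^ 2 := by
    gcongr; nlinarith
  nlinarith

/-- far from the origin, left part -/
lemma left_big (h : Amp a a' K) {T ρ x0 : ℝ} (hT : 0 < T) (hx0 : 1 ≤ x0) (hTρ : T = ρ * AA x0 ^ 3) :
    ‖∫ x in (0 : ℝ)..(x0 / 2), FF a T ρ x‖ ≤ 75 * K / T := by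
  have hK := h.K_nonneg
  have hQ : ∀ x ∈ Set.Icc 0 (x0 / 2), 0 < T - ρ * AA x ^ 3 ∧ |QQ T ρ x| ≤ 16 / 3 := by
    intro x hx
    obtain ⟨h1, h2⟩ := Q_left (q := x0 ^ 2 / 2) hT hx.1 (by linarith [hx.2]) (by positivity)
      (by nlinarith [hx.1, hx.2]) hTρ
    refine ⟨h1, h2.trans ?_⟩
    rw [AA_sq, div_le_iff₀ (by positivity)]
    nlinarith
  refine (seg_L h (M := 16 / 3) (S := K) (S' := 10 * K) hT le_rfl (by linarith)
    (fun x hx => (hQ x hx).1.ne') (fun x hx => (hQ x hx).2)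
    (fun x hx => norm_WW_le_one h hx.1 (abs_nonneg _))
    (int_WW'_le h le_rfl (by linarith) (abs_nonneg _))).trans ?_
  refine div_le_div_of_nonneg_right ?_ hT.le
  linarith

lemma right_big (h : Amp a a' K) {T ρ x0 N : ℝ} (hT : 0 < T) (hx0 : 1 ≤ x0) (hTρ : T = ρ * AA x0 ^ 3)
    (hN : 2 * x0 ≤ N) :
    ‖∫ x in (2 * x0)..N, FF a T ρ x‖ ≤ 75 * K / T := by
  have hK := h.K_nonneg
  have hQ : ∀ x ∈ Set.Icc (2 * x0) N, T - ρ * AA x ^ 3 < 0 ∧ |QQ T ρ x| ≤ 8 / 3 := by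
    intro x hx
    obtain ⟨h1, h2⟩ := Q_right (q := x0 ^ 2) (x0 := x0) (x := x) hT (by linarith) (by linarith [hx.1]) (by positivity)
      (by nlinarith [hx.1, hx.2]) hTρ.le
    refine ⟨h1, h2.trans ?_⟩
    rw [AA_sq, div_le_iff₀ (by positivity)]
    nlinarith
  refine (seg_L h (M := 8 / 3) (S := K) (S' := 10 * K) hT (by linarith) hN
    (fun x hx => (hQ x hx).1.ne) (fun x hx => (hQ x hx).2)
    (fun x hx => norm_WW_le_one h (by linarith [hx.1]) (abs_nonneg _))
    (int_WW'_le h (by linarith) hN (abs_nonneg _))).trans ?_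
  refine div_le_div_of_nonneg_right ?_ hT.le
  linarith

lemma left_small (h : Amp a a' K) {T ρ x0 : ℝ} (hT : 0 < T) (hx0 : 0 < x0) (hx1 : x0 < 1)
    (hTx : 1 ≤ T * x0 ^ 3) (hTρ : T = ρ * AA x0 ^ 3) :
    ‖∫ x in (0 : ℝ)..(x0 / 2), FF a T ρ x‖ ≤ 200 * K / T := by
  have hK := h.K_nonneg
  have hA0 := AA_pos x0
  have hA2 := AA_sq x0
  have hA3 : AA x0 ^ 3 ≤ 4 := by
    have : AA x0 ≤ 3 / 2 := by nlinarith
    calc AA x0 ^ 3 ≤ (3 / 2) ^ 3 := by gcongr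
      _ ≤ 4 := by norm_num
  have hρ : 0 < ρ := by
    by_contra hc
    have := mul_nonneg (neg_nonneg.2 (not_lt.1 hc)) (pow_pos hA0 3).le
    linarith
  set s := √x0 with hs
  have hs0 : 0 < s := Real.sqrt_pos.2 hx0
  have hs2 : s ^ 2 = x0 := Real.sq_sqrt hx0.le
  set D := 2 * s ^ 3 with hD
  have hDρ : 1 ≤ ρ * D ^ 2 := by
    have e : D ^ 2 = 4 * x0 ^ 3 := by rw [hD, ← hs2]; ring
    rw [e]
    have : 1 ≤ ρ * AA x0 ^ 3 * x0 ^ 3 := by rw [← hTρ]; exact hTx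
    have h2 : ρ * AA x0 ^ 3 * x0 ^ 3 ≤ ρ * 4 * x0 ^ 3 := by gcongr
    linarith
  have hD0 : 0 ≤ D := by positivity
  have hQ : ∀ x ∈ Set.Icc 0 (x0 / 2), 0 < T - ρ * AA x ^ 3 ∧ |QQ T ρ x| ≤ 16 / 3 / x0 ^ 2 := by
    intro x hx
    obtain ⟨h1, h2⟩ := Q_left (q := x0 ^ 2 / 2) hT hx.1 (by linarith [hx.2]) (by positivity)
      (by nlinarith [hx.1, hx.2]) hTρ
    refine ⟨h1, h2.trans ?_⟩
    rw [div_le_div_iff₀ (by positivity) (by positivity)]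
    have h3 : 0 < x0 ^ 2 := by positivity
    have h4 : AA x0 ^ 2 ≤ 2 := by rw [hA2]; nlinarith
    have := mul_le_mul_of_nonneg_right h4 h3.le
    linarith
  have hW : ∀ x ∈ Set.Icc 0 (x0 / 2), ‖WW a |ρ| x‖ ≤ K * D * s := by
    intro x hx
    rcases hx.1.eq_or_lt with h0 | h0
    · rw [← h0, WW]
      simp [kk]
      positivity
    · refine (norm_WW_le h h0 hρ hD0 hDρ).1.trans ((div_le_self (by positivity) (AA_one_le x)).trans ?_)
      gcongr
      exact Real.sqrt_le_sqrt (by linarith [hx.2])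
  have hW' : ∫ x in (0 : ℝ)..(x0 / 2), ‖WW' a a' |ρ| x‖ ≤ 12 * (K * D * s) := by
    have key := intervalIntegral.integral_le_sub_of_hasDeriv_right_of_le (a := 0) (b := x0 / 2)
      (g := fun x => 12 * K * D * √x) (g' := fun x => 6 * K * D / √x)
      (φ := fun x => ‖WW' a a' |ρ| x‖) (by linarith) (by fun_prop) ?_ ?_ ?_
    · refine key.trans ?_
      have : √(x0 / 2) ≤ s := Real.sqrt_le_sqrt (by linarith)
      have := mul_le_mul_of_nonneg_left this (by positivity : 0 ≤ K * D)
      simp only [Real.sqrt_zero, mul_zero, sub_zero]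
      linarith
    · intro x hx
      refine ((Real.hasDerivAt_sqrt hx.1.ne').const_mul (12 * K * D)).hasDerivWithinAt.congr_deriv ?_
      have : √x ≠ 0 := (Real.sqrt_pos.2 hx.1).ne'
      field_simp
      ring
    · exact (WW'_cont h |ρ|).norm.continuousOn.integrableOn_Icc
    · intro x hx
      refine (norm_WW_le h hx.1 hρ hD0 hDρ).2.trans ?_
      have := Real.sqrt_pos.2 hx.1
      gcongr
      exact le_mul_of_one_le_right this.le (AA_one_le x)
  refine (seg_L h hT le_rfl (by linarith)
    (fun x hx => (hQ x hx).1.ne') (fun x hx => (hQ x hx).2) hW hW').trans ?_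
  refine div_le_div_of_nonneg_right ?_ hT.le
  rw [← hs2, hD]
  have : 16 / 3 / (s ^ 2) ^ 2 * (4 * (K * (2 * s ^ 3) * s) + 12 * (K * (2 * s ^ 3) * s)) = 512 / 3 * K := by
    field_simp; ring
  rw [this]; linarith

end

section
variable {a a' : ℝ → ℂ} {K : ℝ}

lemma A3_small {x0 : ℝ} (hx0 : 0 ≤ x0) (hx1 : x0 < 1) : AA x0 ^ 3 ≤ 4 ∧ AA x0 ^ 2 ≤ 2 := by
  have hA0 := AA_pos x0
  have hA2 := AA_sq x0
  have : AA x0 ≤ 3 / 2 := by nlinarith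
  constructor
  · calc AA x0 ^ 3 ≤ (3 / 2) ^ 3 := by gcongr
      _ ≤ 4 := by norm_num
  · nlinarith

lemma rho_pos {T ρ x0 : ℝ} (hT : 0 < T) (hTρ : T ≤ ρ * AA x0 ^ 3) : 0 < ρ := by
  by_contra hc
  have := mul_nonneg (neg_nonneg.2 (not_lt.1 hc)) (pow_pos (AA_pos x0) 3).le
  linarith

lemma right_small (h : Amp a a' K) {T ρ x0 l N : ℝ} (hT : 0 < T) (hx0 : 0 ≤ x0) (hx1 : x0 < 1)
    (hl : 0 < l) (hlx : 2 * x0 ≤ l) (hTl : 1 ≤ T * l ^ 3) (hN : l ≤ N) (hTρ : T ≤ ρ * AA x0 ^ 3) :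
    ‖∫ x in l..N, FF a T ρ x‖ ≤ 112 * K / T := by
  have hK := h.K_nonneg
  have hρ := rho_pos hT hTρ
  obtain ⟨hA3, hA2⟩ := A3_small hx0 hx1
  set s := √l with hs
  have hs0 : 0 < s := Real.sqrt_pos.2 hl
  have hs2 : s ^ 2 = l := Real.sq_sqrt hl.le
  set D := 2 * s ^ 3 with hD
  have hDρ : 1 ≤ ρ * D ^ 2 := by
    have e : D ^ 2 = 4 * l ^ 3 := by rw [hD, ← hs2]; ring
    rw [e]
    have h1 : T * l ^ 3 ≤ ρ * AA x0 ^ 3 * l ^ 3 := by gcongr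
    have h2 : ρ * AA x0 ^ 3 * l ^ 3 ≤ ρ * 4 * l ^ 3 := by gcongr
    linarith
  have hD0 : 0 ≤ D := by positivity
  have hQ : ∀ x ∈ Set.Icc l N, T - ρ * AA x ^ 3 < 0 ∧ |QQ T ρ x| ≤ 4 / x ^ 2 := by
    intro x hx
    have hxp : 0 < x := hl.trans_le hx.1
    obtain ⟨h1, h2⟩ := Q_right (q := 3 / 4 * x ^ 2) (x0 := x0) (x := x) hT hx0 (by linarith [hx.1])
      (by positivity) (by nlinarith [hx.1]) hTρ
    refine ⟨h1, h2.trans ?_⟩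
    rw [div_le_div_iff₀ (by positivity) (by positivity)]
    have h3 : 0 < x ^ 2 := by positivity
    have := mul_le_mul_of_nonneg_right hA2 h3.le
    linarith
  have hQ' : ∀ x ∈ Set.Icc l N, |QQ' T ρ x| ≤ 48 / x ^ 3 := by
    intro x hx
    have hxp : 0 < x := hl.trans_le hx.1
    have hA := AA_pos x
    obtain ⟨h1, h2⟩ := hQ x hx
    have e : QQ' T ρ x = 3 * x / AA x ^ 2 * (|QQ T ρ x| * (1 + |QQ T ρ x|)) := by
      have hq : |QQ T ρ x| = T / (ρ * AA x ^ 3 - T) := by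
        rw [QQ, abs_div, abs_of_pos hT, abs_of_neg h1]; ring
      have hE : ρ * AA x ^ 3 - T ≠ 0 := by linarith
      have hE' : (T - ρ * AA x ^ 3) ^ 2 = (ρ * AA x ^ 3 - T) ^ 2 := by ring
      rw [hq, QQ', hE']
      field_simp
      ring
    have hq0 := abs_nonneg (QQ T ρ x)
    rw [e, abs_of_nonneg (by positivity)]
    calc 3 * x / AA x ^ 2 * (|QQ T ρ x| * (1 + |QQ T ρ x|))
        ≤ 3 * x / AA x ^ 2 * (4 / x ^ 2 * (1 + 4 / x ^ 2)) := by gcongr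
      _ ≤ 48 / x ^ 3 := by
        rw [AA_sq]
        have : 3 * x / (1 + x ^ 2) * (4 / x ^ 2 * (1 + 4 / x ^ 2)) = 12 * (x ^ 2 + 4) / ((1 + x ^ 2) * x ^ 3) := by
          field_simp
          ring
        rw [this, div_le_div_iff₀ (by positivity) (by positivity)]
        have : 0 < x ^ 3 := by positivity
        have := mul_le_mul_of_nonneg_right (by nlinarith [sq_nonneg x] : 12 * (x ^ 2 + 4) ≤ 48 * (1 + x ^ 2)) this.le
        linarith
  have hW1 : ∀ x ∈ Set.Icc l N, ‖WW a |ρ| x‖ ≤ K * D * √x := by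
    intro x hx
    have hxp : 0 < x := hl.trans_le hx.1
    exact (norm_WW_le h hxp hρ hD0 hDρ).1.trans (div_le_self (by positivity) (AA_one_le x))
  have hW2 : ∀ x ∈ Set.Icc l N, ‖WW' a a' |ρ| x‖ ≤ 6 * K * D / √x := by
    intro x hx
    have hxp : 0 < x := hl.trans_le hx.1
    refine (norm_WW_le h hxp hρ hD0 hDρ).2.trans ?_
    have := Real.sqrt_pos.2 hxp
    gcongr
    exact le_mul_of_one_le_right this.le (AA_one_le x)
  have hH : ∀ x ∈ Set.Icc l N, HasDerivAt (fun x => WW a |ρ| x * (QQ T ρ x : ℂ))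
      (WW' a a' |ρ| x * (QQ T ρ x : ℂ) + WW a |ρ| x * (QQ' T ρ x : ℂ)) x := fun x hx =>
    (WW_deriv h |ρ| x).mul (QQ_deriv (hQ x hx).1.ne).ofReal_comp
  have hWc : Continuous (WW a |ρ|) := continuous_iff_continuousAt.2 fun x => (WW_deriv h |ρ| x).continuousAt
  have hc1 : ContinuousOn (fun x => (QQ T ρ x : ℂ)) (Set.Icc l N) :=
    fun x hx => (QQ_deriv (hQ x hx).1.ne).ofReal_comp.continuousAt.continuousWithinAt
  have hc2 : ContinuousOn (fun x => (QQ' T ρ x : ℂ)) (Set.Icc l N) :=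
    Complex.continuous_ofReal.comp_continuousOn (QQ'_cont fun x hx => (hQ x hx).1.ne)
  have hHc : ContinuousOn (fun x => WW' a a' |ρ| x * (QQ T ρ x : ℂ) + WW a |ρ| x * (QQ' T ρ x : ℂ)) (Set.Icc l N) :=
    ((WW'_cont h |ρ|).continuousOn.mul hc1).add (hWc.continuousOn.mul hc2)
  have key := osc_H hN (psi_deriv T ρ) (psi'_cont T ρ) hH hHc
  rw [← intervalIntegral.integral_congr (f := fun x => (T : ℂ) * FF a T ρ x)
      (fun x hx => FF_eq (hQ x (by rwa [Set.uIcc_of_le hN] at hx)).1.ne),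
      intervalIntegral.integral_const_mul, norm_mul, Complex.norm_real, Real.norm_eq_abs,
      abs_of_pos hT] at key
  rw [le_div_iff₀ hT, mul_comm]
  refine key.trans ?_
  have hpt : ∀ x ∈ Set.Icc l N, ‖WW a |ρ| x * (QQ T ρ x : ℂ)‖ ≤ 8 * K := by
    intro x hx
    have hxp : 0 < x := hl.trans_le hx.1
    have hsx := Real.sqrt_pos.2 hxp
    have hsx2 : √x ^ 2 = x := Real.sq_sqrt hxp.le
    rw [norm_mul, Complex.norm_real, Real.norm_eq_abs]
    calc ‖WW a |ρ| x‖ * |QQ T ρ x| ≤ (K * D * √x) * (4 / x ^ 2) := by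
          gcongr
          · exact hW1 x hx
          · exact (hQ x hx).2
      _ = 8 * K * (s ^ 3 / √x ^ 3) := by
          rw [hD]; nth_rewrite 2 [← hsx2]; field_simp; ring
      _ ≤ 8 * K * 1 := by
          gcongr
          rw [div_le_one (by positivity)]
          gcongr
          exact Real.sqrt_le_sqrt hx.1
      _ = 8 * K := mul_one _
  have hInt : ∫ x in l..N, ‖WW' a a' |ρ| x * (QQ T ρ x : ℂ) + WW a |ρ| x * (QQ' T ρ x : ℂ)‖ ≤ 96 * K := by
    have k2 := intervalIntegral.integral_le_sub_of_hasDeriv_right_of_le (a := l) (b := N)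
      (g := fun x => -(48 * K * D) * (x * √x)⁻¹) (g' := fun x => 72 * K * D / (x ^ 2 * √x))
      (φ := fun x => ‖WW' a a' |ρ| x * (QQ T ρ x : ℂ) + WW a |ρ| x * (QQ' T ρ x : ℂ)‖) hN ?_ ?_ ?_ ?_
    · refine k2.trans ?_
      have hNp : 0 < N := hl.trans_le hN
      have hsN := Real.sqrt_pos.2 hNp
      have h1 : 0 ≤ 48 * K * D * (N * √N)⁻¹ := by positivity
      have h2 : 48 * K * D * (l * √l)⁻¹ = 96 * K := by
        rw [← hs, ← hs2, hD]; field_simp; ring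
      linarith
    · intro x hx
      have hxp : 0 < x := hl.trans_le hx.1
      have hsx := Real.sqrt_pos.2 hxp
      apply ContinuousAt.continuousWithinAt
      exact ContinuousAt.mul (by fun_prop) (ContinuousAt.inv₀ (by fun_prop) (by positivity))
    · intro x hx
      have hxp : 0 < x := hl.trans hx.1
      have hsx := Real.sqrt_pos.2 hxp
      have hsx2 : √x ^ 2 = x := Real.sq_sqrt hxp.le
      have h1 := ((hasDerivAt_id x).mul (Real.hasDerivAt_sqrt hxp.ne')).inv (mul_ne_zero hxp.ne' hsx.ne')
      refine (h1.const_mul (-(48 * K * D))).hasDerivWithinAt.congr_deriv ?_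
      simp only [Pi.mul_apply, id]
      field_simp
      rw [hsx2]
      ring
    · exact hHc.norm.integrableOn_Icc
    · intro x hx
      have hx' : x ∈ Set.Icc l N := ⟨hx.1.le, hx.2.le⟩
      have hxp : 0 < x := hl.trans hx.1
      have hsx := Real.sqrt_pos.2 hxp
      have hsx2 : √x ^ 2 = x := Real.sq_sqrt hxp.le
      have e : 72 * K * D / (x ^ 2 * √x) = (6 * K * D / √x) * (4 / x ^ 2) + (K * D * √x) * (48 / x ^ 3) := by
        field_simp
        rw [hsx2]
        ring
      rw [e]
      refine (norm_add_le _ _).trans (add_le_add ?_ ?_)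
      · rw [norm_mul, Complex.norm_real, Real.norm_eq_abs]
        gcongr
        · exact hW2 x hx'
        · exact (hQ x hx').2
      · rw [norm_mul, Complex.norm_real, Real.norm_eq_abs]
        gcongr
        · exact hW1 x hx'
        · exact hQ' x hx'
  have h1 := hpt l ⟨le_rfl, hN⟩
  have h2 := hpt N ⟨hN, le_rfl⟩
  linarith

lemma middle (h : Amp a a' K) {T ρ x0 : ℝ} (hT : 0 < T) (hx0 : 0 < x0) (hTρ : T = ρ * AA x0 ^ 3) :
    ‖∫ x in (x0 / 2)..(2 * x0), FF a T ρ x‖ ≤ 204 * K / T := by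
  have hK := h.K_nonneg
  have hρ := rho_pos hT hTρ.le
  have hA0 := AA_pos x0
  set s := √x0 with hs
  have hs0 : 0 < s := Real.sqrt_pos.2 hx0
  have hs2 : s ^ 2 = x0 := Real.sq_sqrt hx0.le
  set D := √(1 / ρ) with hD
  have hD0 : 0 < D := Real.sqrt_pos.2 (by positivity)
  have hD2 : ρ * D ^ 2 = 1 := by rw [hD, Real.sq_sqrt (by positivity)]; field_simp
  set d := D * AA x0 / s with hd
  have hd0 : 0 < d := by positivity
  have basic : ∀ x ∈ Set.Icc (x0 / 2) (2 * x0), √x ≤ 2 * s ∧ s / 2 ≤ √x ∧ AA x0 / 2 ≤ AA x := by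
    intro x hx
    refine ⟨?_, ?_, ?_⟩
    · rw [Real.sqrt_le_left (by positivity)]; nlinarith [hx.2]
    · apply Real.le_sqrt_of_sq_le; nlinarith [hx.1]
    · apply Real.le_sqrt_of_sq_le
      have : (AA x0 / 2) ^ 2 = (1 + x0 ^ 2) / 4 := by rw [← AA_sq]; ring
      rw [this]; nlinarith [hx.1]
  have hF : ∀ x ∈ Set.Icc (x0 / 2) (2 * x0), ‖FF a T ρ x‖ ≤ 32 * K * D * s / AA x0 ^ 4 := by
    intro x hx
    have hxp : 0 < x := lt_of_lt_of_le (by positivity) hx.1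
    obtain ⟨b1, b2, b3⟩ := basic x hx
    refine (norm_FF_le h hxp hρ hD0.le hD2.ge).2.2.trans ?_
    calc K * D * √x / AA x ^ 4 ≤ K * D * (2 * s) / (AA x0 / 2) ^ 4 := by gcongr
      _ = _ := by field_simp; ring
  have hS : ∀ x ∈ Set.Icc (x0 / 2) (2 * x0), ‖WW a |ρ| x‖ ≤ 4 * (K * D * s / AA x0) := by
    intro x hx
    have hxp : 0 < x := lt_of_lt_of_le (by positivity) hx.1
    obtain ⟨b1, b2, b3⟩ := basic x hx
    refine (norm_WW_le h hxp hρ hD0.le hD2.ge).1.trans ?_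
    calc K * D * √x / AA x ≤ K * D * (2 * s) / (AA x0 / 2) := by gcongr
      _ = _ := by field_simp; ring
  have hS1 : ∀ x ∈ Set.Icc (x0 / 2) (2 * x0), ‖WW' a a' |ρ| x‖ ≤ 24 * K * D / (s * AA x0) := by
    intro x hx
    have hxp : 0 < x := lt_of_lt_of_le (by positivity) hx.1
    obtain ⟨b1, b2, b3⟩ := basic x hx
    refine (norm_WW_le h hxp hρ hD0.le hD2.ge).2.trans ?_
    calc 6 * K * D / (√x * AA x) ≤ 6 * K * D / ((s / 2) * (AA x0 / 2)) := by gcongr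
      _ = _ := by field_simp; ring
  have hS' : ∀ l u, x0 / 2 ≤ l → l ≤ u → u ≤ 2 * x0 →
      ∫ x in l..u, ‖WW' a a' |ρ| x‖ ≤ 36 * (K * D * s / AA x0) := by
    intro l u hl hlu hu
    have : ∫ x in l..u, ‖WW' a a' |ρ| x‖ ≤ ∫ x in l..u, 24 * K * D / (s * AA x0) :=
      intervalIntegral.integral_mono_on hlu ((WW'_cont h |ρ|).norm.intervalIntegrable _ _)
        (by simp) (fun x hx => hS1 x ⟨hl.trans hx.1, hx.2.trans hu⟩)
    refine this.trans ?_
    rw [intervalIntegral.integral_const, smul_eq_mul]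
    calc (u - l) * (24 * K * D / (s * AA x0)) ≤ (3 / 2 * s ^ 2) * (24 * K * D / (s * AA x0)) := by
          gcongr; linarith
      _ = _ := by field_simp; ring
  have hi := fun l u => (FF_cont h T ρ).intervalIntegrable (μ := volume) l u
  have triv : ∀ l u m : ℝ, x0 / 2 ≤ l → l ≤ u → u ≤ 2 * x0 → u - l ≤ m * d →
      ‖∫ x in l..u, FF a T ρ x‖ ≤ m * 32 * K / T := by
    intro l u m hl hlu hu hm
    have := intervalIntegral.norm_integral_le_of_norm_le_const (f := FF a T ρ) (a := l) (b := u)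
      (C := 32 * K * D * s / AA x0 ^ 4) (fun x hx => by
        rw [Set.uIoc_of_le hlu] at hx
        exact hF x ⟨hl.trans hx.1.le, hx.2.trans hu⟩)
    refine this.trans ?_
    rw [abs_of_nonneg (by linarith)]
    calc 32 * K * D * s / AA x0 ^ 4 * (u - l) ≤ 32 * K * D * s / AA x0 ^ 4 * (m * d) := by gcongr
      _ = m * 32 * K * (ρ * D ^ 2) / (ρ * AA x0 ^ 3) := by rw [hd]; field_simp
      _ = _ := by rw [hD2, ← hTρ, mul_one]
  have fin : 4 / 3 * AA x0 ^ 2 / (d * x0) * (4 * (4 * (K * D * s / AA x0)) + 36 * (K * D * s / AA x0)) / T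
      = 208 / 3 * K / T := by
    rw [hd]
    generalize AA x0 = A at *
    rw [← hs2]; field_simp; ring
  rcases le_total (x0 / 2) d with hdx | hdx
  · refine (triv (x0 / 2) (2 * x0) 3 le_rfl (by linarith) le_rfl (by linarith)).trans ?_
    refine div_le_div_of_nonneg_right ?_ hT.le
    linarith
  · have p1 : ‖∫ x in (x0 / 2)..(x0 - d), FF a T ρ x‖ ≤ 208 / 3 * K / T := by
      rw [← fin]
      have hQ : ∀ x ∈ Set.Icc (x0 / 2) (x0 - d), 0 < T - ρ * AA x ^ 3 ∧
          |QQ T ρ x| ≤ 4 / 3 * AA x0 ^ 2 / (d * x0) := fun x hx =>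
        Q_left hT (by linarith [hx.1]) (by linarith [hx.2]) (by positivity)
          (by nlinarith [hx.1, hx.2]) hTρ
      exact seg_L h hT (by linarith) (by linarith) (fun x hx => (hQ x hx).1.ne') (fun x hx => (hQ x hx).2)
        (fun x hx => hS x ⟨hx.1, by linarith [hx.2]⟩) (hS' _ _ le_rfl (by linarith) (by linarith))
    have p3 : ‖∫ x in (x0 + d)..(2 * x0), FF a T ρ x‖ ≤ 208 / 3 * K / T := by
      rw [← fin]
      have hQ : ∀ x ∈ Set.Icc (x0 + d) (2 * x0), T - ρ * AA x ^ 3 < 0 ∧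
          |QQ T ρ x| ≤ 4 / 3 * AA x0 ^ 2 / (d * x0) := fun x hx =>
        Q_right hT hx0.le (by linarith [hx.1]) (by positivity)
          (by nlinarith [hx.1, hx.2]) hTρ.le
      exact seg_L h hT (by linarith) (by linarith) (fun x hx => (hQ x hx).1.ne) (fun x hx => (hQ x hx).2)
        (fun x hx => hS x ⟨by linarith [hx.1], hx.2⟩) (hS' _ _ (by linarith) (by linarith) le_rfl)
    have p2 := triv (x0 - d) (x0 + d) 2 (by linarith) (by linarith) (by linarith) (by linarith)
    rw [← intervalIntegral.integral_add_adjacent_intervals (hi (x0 / 2) (x0 - d)) (hi (x0 - d) (2 * x0)),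
      ← intervalIntegral.integral_add_adjacent_intervals (hi (x0 - d) (x0 + d)) (hi (x0 + d) (2 * x0))]
    refine (norm_add_le _ _).trans ((add_le_add p1 ((norm_add_le _ _).trans (add_le_add p2 p3))).trans ?_)
    rw [← add_div, ← add_div]
    refine div_le_div_of_nonneg_right ?_ hT.le
    linarith

lemma near_zero (h : Amp a a' K) {T ρ x0 l : ℝ} (hT : 0 < T) (hx0 : 0 ≤ x0) (hx1 : x0 < 1)
    (hl : 0 < l) (hTl : T * l ^ 3 = 8) (hTρ : T ≤ ρ * AA x0 ^ 3) :
    ‖∫ x in (0 : ℝ)..l, FF a T ρ x‖ ≤ 6 * K / T := by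
  have hK := h.K_nonneg
  have hρ := rho_pos hT hTρ
  obtain ⟨hA3, hA2⟩ := A3_small hx0 hx1
  set D := √(4 / T) with hD
  have hD0 : 0 ≤ D := Real.sqrt_nonneg _
  have hD2 : D ^ 2 = 4 / T := Real.sq_sqrt (by positivity)
  have hDρ : 1 ≤ ρ * D ^ 2 := by
    rw [hD2, ← mul_div_assoc, one_le_div hT]
    refine hTρ.trans (by gcongr)
  have := intervalIntegral.norm_integral_le_of_norm_le_const (f := FF a T ρ) (a := 0) (b := l)
      (C := K * D * √l) (fun x hx => by
        rw [Set.uIoc_of_le hl.le] at hx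
        refine (norm_FF_le h hx.1 hρ hD0 hDρ).2.2.trans
          ((div_le_self (by positivity) (one_le_pow₀ (AA_one_le x))).trans ?_)
        gcongr
        exact hx.2)
  refine this.trans ?_
  rw [sub_zero, abs_of_pos hl]
  have e : D * √l * l ≤ 6 / T := by
    refine (sq_le_sq₀ (by positivity) (by positivity)).1 ?_
    rw [mul_pow, mul_pow, hD2, Real.sq_sqrt hl.le]
    have : l ^ 3 = 8 / T := by field_simp; linarith
    calc 4 / T * l * l ^ 2 = 4 / T * l ^ 3 := by ring
      _ = 32 / T ^ 2 := by rw [this]; field_simp; norm_num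
      _ ≤ 36 / T ^ 2 := by gcongr; norm_num
      _ = (6 / T) ^ 2 := by rw [div_pow]; norm_num
  calc K * D * √l * l = K * (D * √l * l) := by ring
    _ ≤ K * (6 / T) := by gcongr
    _ = _ := by ring

lemma exists_x0 {T ρ : ℝ} (hT : 0 < T) (hρ : 0 < ρ) (hTρ : ρ < T) :
    ∃ x0 : ℝ, 0 < x0 ∧ T = ρ * AA x0 ^ 3 := by
  set c := (T / ρ) ^ ((1 : ℝ) / 3) with hc
  have h1 : 1 < T / ρ := (one_lt_div hρ).2 hTρ
  have hc1 : 1 < c := Real.one_lt_rpow h1 (by norm_num)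
  have hc3 : c ^ 3 = T / ρ := by
    rw [hc, ← Real.rpow_natCast, ← Real.rpow_mul (by positivity)]; norm_num
  refine ⟨√(c ^ 2 - 1), Real.sqrt_pos.2 (by nlinarith), ?_⟩
  have : AA √(c ^ 2 - 1) = c := by
    rw [AA, Real.sq_sqrt (by nlinarith), add_sub_cancel, Real.sqrt_sq (by linarith)]
  rw [this, hc3]; field_simp

lemma osc_finite (h : Amp a a' K) {T ρ : ℝ} (hT : 0 < T) :
    ∃ N0 : ℝ, ∀ N, N0 ≤ N → ‖∫ x in (0 : ℝ)..N, FF a T ρ x‖ ≤ 600 * K / T := by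
  have hK := h.K_nonneg
  have hi := fun l u => (FF_cont h T ρ).intervalIntegrable (μ := volume) l u
  rcases le_or_gt ρ 0 with hρ | hρ
  · refine ⟨0, fun N hN => (case_good h hT hρ hN).trans ?_⟩
    gcongr; norm_num
  set l := 2 * T ^ (-(1 : ℝ) / 3) with hl
  have hlp : 0 < l := by positivity
  have hTl : T * l ^ 3 = 8 := by
    have : (T ^ (-(1 : ℝ) / 3)) ^ 3 = T⁻¹ := by
      rw [← Real.rpow_natCast, ← Real.rpow_mul hT.le]
      norm_num
      exact Real.rpow_neg_one T
    rw [hl, mul_pow, this]; field_simp; norm_num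
  have small : ∀ x0, 0 ≤ x0 → x0 < 1 → 2 * x0 ≤ l → T ≤ ρ * AA x0 ^ 3 →
      ∀ N, l ≤ N → ‖∫ x in (0 : ℝ)..N, FF a T ρ x‖ ≤ 600 * K / T := by
    intro x0 h0 h1 h2 h3 N hN
    rw [← intervalIntegral.integral_add_adjacent_intervals (hi 0 l) (hi l N)]
    refine (norm_add_le _ _).trans ((add_le_add (near_zero h hT h0 h1 hlp hTl h3)
      (right_small h hT h0 h1 hlp h2 (by linarith) hN h3)).trans ?_)
    rw [← add_div]
    refine div_le_div_of_nonneg_right ?_ hT.le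
    linarith
  rcases le_or_gt T ρ with hTρ | hTρ
  · refine ⟨l, small 0 le_rfl one_pos (by linarith) ?_⟩
    simpa [AA] using hTρ
  obtain ⟨x0, h0, hx⟩ := exists_x0 hT hρ hTρ
  have split : ∀ N c1 c3 : ℝ, ‖∫ x in (0 : ℝ)..(x0 / 2), FF a T ρ x‖ ≤ c1 * K / T →
      ‖∫ x in (2 * x0)..N, FF a T ρ x‖ ≤ c3 * K / T → c1 ≤ 200 → c3 ≤ 112 →
      ‖∫ x in (0 : ℝ)..N, FF a T ρ x‖ ≤ 600 * K / T := by
    intro N c1 c3 h1 h3 hc1 hc3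
    have h2 := middle h hT h0 hx
    rw [← intervalIntegral.integral_add_adjacent_intervals (hi 0 (x0 / 2)) (hi (x0 / 2) N),
      ← intervalIntegral.integral_add_adjacent_intervals (hi (x0 / 2) (2 * x0)) (hi (2 * x0) N)]
    refine (norm_add_le _ _).trans ((add_le_add h1 ((norm_add_le _ _).trans (add_le_add h2 h3))).trans ?_)
    rw [← add_div, ← add_div]
    refine div_le_div_of_nonneg_right ?_ hT.le
    nlinarith
  rcases le_or_gt 1 x0 with h1 | h1
  · refine ⟨2 * x0, fun N hN => split N 75 75 (left_big h hT h1 hx) (right_big h hT h1 hx hN)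
      (by norm_num) (by norm_num)⟩
  rcases le_or_gt (2 * x0) l with h2 | h2
  · exact ⟨l, small x0 h0.le h1 h2 hx.le⟩
  have h8 : 8 ≤ T * (2 * x0) ^ 3 := by
    rw [← hTl]; gcongr
  refine ⟨2 * x0, fun N hN => split N 200 112 (left_small h hT h0 h1 (by linarith) hx)
    (right_small h hT h0.le h1 (by linarith) le_rfl (by linarith) hN hx.le) le_rfl le_rfl⟩

lemma gg_integrable : IntegrableOn gg (Set.Ioi 0) := by
  have hc : Continuous gg := by
    unfold gg; exact continuous_id.div (by fun_prop) (fun x => by positivity)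
  refine (integrable_inv_one_add_sq.integrableOn (s := Set.Ioi 0)).mono' hc.aestronglyMeasurable ?_
  filter_upwards [ae_restrict_mem measurableSet_Ioi] with x hx
  rw [Real.norm_eq_abs, abs_of_nonneg (gg_nonneg (le_of_lt hx)), gg, ← one_div,
    div_le_div_iff₀ (by positivity) (by positivity)]
  have : (0 : ℝ) < x := hx
  nlinarith [sq_nonneg (x - 1), pow_pos this 3, pow_pos this 4, sq_nonneg x]

lemma osc_FF (h : Amp a a' K) {T : ℝ} (ρ : ℝ) (hT : 0 < T) :
    ‖∫ x in Set.Ioi (0 : ℝ), FF a T ρ x‖ ≤ 600 * K / T := by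
  have hK := h.K_nonneg
  have hInt : IntegrableOn (FF a T ρ) (Set.Ioi 0) := by
    refine (gg_integrable.mul_const K).mono' (FF_cont h T ρ).aestronglyMeasurable ?_
    filter_upwards [ae_restrict_mem measurableSet_Ioi] with x hx
    have hx0 : (0 : ℝ) < x := hx
    have : (I * ((T * phB x - ρ * x : ℝ) : ℂ)).re = 0 := by simp
    rw [FF, norm_mul, norm_mul, norm_exp, Complex.norm_real, Real.norm_eq_abs, this, Real.exp_zero, one_mul,
      abs_of_nonneg (gg_nonneg hx0.le)]
    refine mul_le_mul_of_nonneg_left ?_ (gg_nonneg hx0.le)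
    have hn : 0 ≤ |ρ| * x := by positivity
    exact (h.h0 _ hn).trans (div_le_self hK (by rw [Real.one_le_sqrt]; linarith))
  have lim := intervalIntegral_tendsto_integral_Ioi 0 hInt Filter.tendsto_id
  obtain ⟨N0, hN0⟩ := osc_finite h (ρ := ρ) hT
  refine le_of_tendsto lim.norm ?_
  filter_upwards [Filter.eventually_ge_atTop N0] with N hN
  exact hN0 N hN

end

noncomputable def JJ (Θ : ℝ → ℂ) (s ρ : ℝ) : ℂ :=
  ∫ θ in (-π)..π, cexp (I * ((ρ * (Real.cos θ - s) : ℝ) : ℂ)) * Θ θ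

lemma norm_cexp_I_mul (x : ℝ) : ‖cexp (I * (x : ℂ))‖ = 1 := by
  rw [mul_comm]; exact Complex.norm_exp_ofReal_mul_I x

lemma JJ_deriv {Θ : ℝ → ℂ} (hΘ : Continuous Θ) (s ρ : ℝ) :
    HasDerivAt (JJ Θ s) (JJ (fun θ => I * ((Real.cos θ - s : ℝ) : ℂ) * Θ θ) s ρ) ρ := by
  unfold JJ
  refine (intervalIntegral.hasDerivAt_integral_of_dominated_loc_of_deriv_le (s := Set.univ)
    (F := fun ρ θ => cexp (I * ((ρ * (Real.cos θ - s) : ℝ) : ℂ)) * Θ θ)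
    (F' := fun ρ θ => cexp (I * ((ρ * (Real.cos θ - s) : ℝ) : ℂ)) * (I * ((Real.cos θ - s : ℝ) : ℂ) * Θ θ))
    (bound := fun θ => ‖I * ((Real.cos θ - s : ℝ) : ℂ) * Θ θ‖)
    Filter.univ_mem ?_ ?_ ?_ ?_ ?_ ?_).2
  · exact Filter.Eventually.of_forall fun x => (by fun_prop : Continuous _).aestronglyMeasurable
  · exact (by fun_prop : Continuous _).intervalIntegrable _ _
  · exact (by fun_prop : Continuous _).aestronglyMeasurable
  · refine Filter.Eventually.of_forall fun θ _ x _ => ?_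
    rw [norm_mul, norm_cexp_I_mul, one_mul]
  · exact (by fun_prop : Continuous _).intervalIntegrable _ _
  · refine Filter.Eventually.of_forall fun θ _ x _ => ?_
    have h1 : HasDerivAt (fun x : ℝ => x * (Real.cos θ - s)) (Real.cos θ - s) x := by
      simpa using (hasDerivAt_id x).mul_const (Real.cos θ - s)
    have h2 := ((h1.ofReal_comp.const_mul I).cexp).mul_const (Θ θ)
    refine h2.congr_deriv ?_
    ring

lemma int_w {ρ : ℝ} (hρ : 0 ≤ ρ) :
    ∫ θ in (-π)..π, 1 / (1 + ρ * Real.sin θ ^ 2) ≤ 20 / √(1 + ρ) := by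
  have hwc : Continuous fun θ => 1 / (1 + ρ * Real.sin θ ^ 2) :=
    continuous_const.div (by fun_prop) (fun x => by positivity)
  have hper : Function.Periodic (fun θ => 1 / (1 + ρ * Real.sin θ ^ 2)) π := by
    intro θ; simp [Real.sin_add_pi]
  have hs : 0 < √(1 + ρ) := Real.sqrt_pos.2 (by linarith)
  have hs2 : √(1 + ρ) ^ 2 = 1 + ρ := Real.sq_sqrt (by linarith)
  have hpi := Real.pi_pos
  set b := 2 * √(1 + ρ) / π with hb
  have hb0 : 0 < b := by positivity
  have e1 : ∫ θ in (-π)..π, 1 / (1 + ρ * Real.sin θ ^ 2) =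
      2 * ∫ θ in (-(π/2))..(π/2), 1 / (1 + ρ * Real.sin θ ^ 2) := by
    rw [← intervalIntegral.integral_add_adjacent_intervals (hwc.intervalIntegrable (-π) 0) (hwc.intervalIntegrable 0 π)]
    have h1 := hper.intervalIntegral_add_eq (-π) (-(π/2))
    have h2 := hper.intervalIntegral_add_eq 0 (-(π/2))
    rw [show -π + π = 0 by ring, show -(π/2) + π = π/2 by ring] at h1
    rw [show 0 + π = π by ring, show -(π/2) + π = π/2 by ring] at h2
    rw [h1, h2]; ring
  have e2 : ∫ θ in (-(π/2))..(π/2), 1 / (1 + ρ * Real.sin θ ^ 2) ≤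
      2 / b * Real.arctan (b * (π / 2)) - 2 / b * Real.arctan (b * (-(π / 2))) := by
    refine intervalIntegral.integral_le_sub_of_hasDeriv_right_of_le
      (g := fun θ => 2 / b * Real.arctan (b * θ)) (g' := fun θ => 2 / (1 + (b * θ) ^ 2)) (by linarith) ?_ ?_ ?_ ?_
    · exact (by fun_prop : Continuous _).continuousOn
    · intro x hx
      have h1 : HasDerivAt (fun x => b * x) b x := by simpa using (hasDerivAt_id x).const_mul b
      refine ((h1.arctan.const_mul (2 / b)).hasDerivWithinAt).congr_deriv ?_
      have : 0 < 1 + (b * x) ^ 2 := by positivity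
      field_simp
    · exact hwc.continuousOn.integrableOn_Icc
    · intro x hx
      have h1 : (2 / π * |x|) ^ 2 ≤ Real.sin x ^ 2 := by
        have := Real.mul_abs_le_abs_sin (x := x) (abs_le.2 ⟨hx.1.le, hx.2.le⟩)
        rw [← sq_abs (Real.sin x)]
        gcongr
      rw [mul_pow, sq_abs] at h1
      have h2 := Real.sin_sq_le_one x
      rw [div_le_div_iff₀ (by positivity) (by positivity)]
      have h3 : (b * x) ^ 2 = (1 + ρ) * ((2 / π) ^ 2 * x ^ 2) := by
        rw [← hs2, hb]; ring
      rw [h3]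
      nlinarith
  have e3 : 2 / b * Real.arctan (b * (π / 2)) - 2 / b * Real.arctan (b * (-(π / 2))) ≤ 2 / b * π := by
    have := Real.arctan_lt_pi_div_two (b * (π / 2))
    have := Real.neg_pi_div_two_lt_arctan (b * (-(π / 2)))
    rw [← mul_sub]
    gcongr
    linarith
  rw [e1]
  calc 2 * ∫ θ in (-(π/2))..(π/2), 1 / (1 + ρ * Real.sin θ ^ 2) ≤ 2 * (2 / b * π) := by linarith
    _ = 2 * π ^ 2 / √(1 + ρ) := by rw [hb]; field_simp
    _ ≤ 20 / √(1 + ρ) := by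
      gcongr
      nlinarith [Real.pi_lt_d2]

lemma JJ_zero_eq (Θ : ℝ → ℂ) (s ρ : ℝ) :
    JJ Θ s ρ = cexp (I * ((-(ρ * s) : ℝ) : ℂ)) * JJ Θ 0 ρ := by
  unfold JJ
  rw [← intervalIntegral.integral_const_mul]
  congr 1; ext θ
  rw [← mul_assoc, ← Complex.exp_add]
  congr 2
  push_cast; ring

lemma norm_JJ_eq (Θ : ℝ → ℂ) (s ρ : ℝ) : ‖JJ Θ s ρ‖ = ‖JJ Θ 0 ρ‖ := by
  rw [JJ_zero_eq, norm_mul, norm_cexp_I_mul, one_mul]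

lemma lemA {Θ Θ1 : ℝ → ℂ} {M : ℝ} (hd : ∀ θ, HasDerivAt Θ (Θ1 θ) θ) (hc : Continuous Θ1)
    (h0 : ∀ θ, ‖Θ θ‖ ≤ M) (h1 : ∀ θ, ‖Θ1 θ‖ ≤ M) {ρ : ℝ} (hρ : 0 ≤ ρ) (s : ℝ) :
    ‖JJ Θ s ρ‖ ≤ 100 * M / √(1 + ρ) := by
  have hM : 0 ≤ M := (norm_nonneg _).trans (h0 0)
  have hΘc : Continuous Θ := continuous_iff_continuousAt.2 fun x => (hd x).continuousAt
  rw [norm_JJ_eq]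
  set w : ℝ → ℝ := fun θ => 1 + ρ * Real.sin θ ^ 2 with hw
  have hw0 : ∀ θ, 0 < w θ := fun θ => by simp only [hw]; positivity
  have hwd : ∀ θ, HasDerivAt w (2 * ρ * Real.sin θ * Real.cos θ) θ := by
    intro θ
    refine ((((Real.hasDerivAt_sin θ).pow 2).const_mul ρ).const_add 1).congr_deriv ?_
    simp; ring
  have hwc : Continuous w := by simp only [hw]; fun_prop
  have hvd : ∀ θ, HasDerivAt (fun θ => Real.sin θ / w θ)
      ((Real.cos θ * w θ - Real.sin θ * (2 * ρ * Real.sin θ * Real.cos θ)) / w θ ^ 2) θ := fun θ =>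
    (Real.hasDerivAt_sin θ).div (hwd θ) (hw0 θ).ne'
  set v' : ℝ → ℝ := fun θ => (Real.cos θ * w θ - Real.sin θ * (2 * ρ * Real.sin θ * Real.cos θ)) / w θ ^ 2 with hv'
  have hv'c : Continuous v' := Continuous.div (by fun_prop) (by fun_prop) (fun x => (pow_pos (hw0 x) 2).ne')
  have hvc : Continuous fun θ => Real.sin θ / w θ := Continuous.div (by fun_prop) hwc (fun x => (hw0 x).ne')
  have hwic : Continuous fun θ => (w θ)⁻¹ := hwc.inv₀ (fun x => (hw0 x).ne')
  have key := osc_H (a := -π) (b := π) (by linarith [Real.pi_pos]) (ψ := fun θ => ρ * Real.cos θ)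
    (ψ' := fun θ => -(ρ * Real.sin θ)) (H := fun θ => ((Real.sin θ / w θ : ℝ) : ℂ) * Θ θ)
    (H' := fun θ => (v' θ : ℂ) * Θ θ + ((Real.sin θ / w θ : ℝ) : ℂ) * Θ1 θ)
    (fun x => by simpa using (Real.hasDerivAt_cos x).const_mul ρ) (by fun_prop)
    (fun x _ => ((hvd x).ofReal_comp).mul (hd x))
    (by
      apply Continuous.continuousOn
      exact ((Complex.continuous_ofReal.comp hv'c).mul hΘc).add ((Complex.continuous_ofReal.comp hvc).mul hc))
  simp only [Real.sin_neg, Real.sin_pi, neg_zero, zero_div, Complex.ofReal_zero, zero_mul, norm_zero, zero_add] at key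
  have e : JJ Θ 0 ρ = (∫ θ in (-π)..π, cexp (I * ((ρ * Real.cos θ : ℝ) : ℂ)) * (((w θ)⁻¹ : ℝ) : ℂ) * Θ θ)
      - ∫ θ in (-π)..π, cexp (I * ((ρ * Real.cos θ : ℝ) : ℂ)) * ((-(ρ * Real.sin θ) : ℝ) : ℂ) * (((Real.sin θ / w θ : ℝ) : ℂ) * Θ θ) := by
    have c1 : Continuous fun θ => ((w θ)⁻¹ : ℝ) := hwic
    rw [← intervalIntegral.integral_sub]
    · unfold JJ
      congr 1; ext θ
      rw [sub_zero]
      have : ((w θ)⁻¹ : ℝ) + ρ * Real.sin θ * (Real.sin θ / w θ) = 1 := by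
        have := (hw0 θ).ne'
        field_simp
        simp only [hw]
      have h2 := congrArg (fun r : ℝ => (r : ℂ)) this
      simp only [Complex.ofReal_add, Complex.ofReal_mul, Complex.ofReal_one] at h2
      simp only [Complex.ofReal_neg, Complex.ofReal_mul]
      linear_combination (-cexp (I * ((ρ : ℂ) * (Real.cos θ : ℂ))) * Θ θ) * h2
    · refine Continuous.intervalIntegrable ?_ _ _
      exact (Continuous.mul (by fun_prop) (Complex.continuous_ofReal.comp c1)).mul hΘc
    · refine Continuous.intervalIntegrable ?_ _ _
      exact Continuous.mul (by fun_prop) ((Complex.continuous_ofReal.comp hvc).mul hΘc)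
  rw [e]
  refine (norm_sub_le _ _).trans ?_
  have hpi : -π ≤ π := by linarith [Real.pi_pos]
  have iw : IntervalIntegrable (fun θ => 1 / (1 + ρ * Real.sin θ ^ 2)) volume (-π) π := by
    refine Continuous.intervalIntegrable ?_ _ _
    simpa [hw] using hwic
  have b1 : ‖∫ θ in (-π)..π, cexp (I * ((ρ * Real.cos θ : ℝ) : ℂ)) * (((w θ)⁻¹ : ℝ) : ℂ) * Θ θ‖ ≤
      ∫ θ in (-π)..π, M * (1 / (1 + ρ * Real.sin θ ^ 2)) := by
    refine intervalIntegral.norm_integral_le_of_norm_le hpi ?_ (iw.const_mul M)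
    refine Filter.Eventually.of_forall fun θ _ => ?_
    rw [norm_mul, norm_mul, norm_cexp_I_mul, one_mul, Complex.norm_real, Real.norm_eq_abs,
      abs_of_pos (inv_pos.2 (hw0 θ)), mul_comm, one_div]
    have := h0 θ
    have := inv_pos.2 (hw0 θ)
    change ‖Θ θ‖ * (w θ)⁻¹ ≤ M * (w θ)⁻¹
    gcongr
  have b2 : ∫ θ in (-π)..π, ‖(v' θ : ℂ) * Θ θ + ((Real.sin θ / w θ : ℝ) : ℂ) * Θ1 θ‖ ≤
      ∫ θ in (-π)..π, (4 * M) * (1 / (1 + ρ * Real.sin θ ^ 2)) := by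
    refine intervalIntegral.integral_mono_on hpi ?_ (iw.const_mul _) ?_
    · refine (Continuous.norm ?_).intervalIntegrable _ _
      exact ((Complex.continuous_ofReal.comp hv'c).mul hΘc).add ((Complex.continuous_ofReal.comp hvc).mul hc)
    · intro θ _
      have hwp := hw0 θ
      have hs1 := Real.abs_sin_le_one θ
      have hc1 := Real.abs_cos_le_one θ
      have q1 : |v' θ| ≤ 3 / w θ := by
        rw [hv', abs_div, abs_of_pos (pow_pos hwp 2), div_le_div_iff₀ (pow_pos hwp 2) hwp]
        have : |Real.cos θ * w θ - Real.sin θ * (2 * ρ * Real.sin θ * Real.cos θ)| ≤ 3 * w θ := by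
          have : Real.cos θ * w θ - Real.sin θ * (2 * ρ * Real.sin θ * Real.cos θ) =
            Real.cos θ * (w θ - 2 * (ρ * Real.sin θ ^ 2)) := by ring
          rw [this, abs_mul]
          have h3 : |w θ - 2 * (ρ * Real.sin θ ^ 2)| ≤ 3 * w θ := by
            have : 0 ≤ ρ * Real.sin θ ^ 2 := by positivity
            rw [abs_le]; simp only [hw]; constructor <;> linarith
          calc _ ≤ 1 * (3 * w θ) := by gcongr
            _ = _ := one_mul _
        nlinarith
      have q2 : |Real.sin θ / w θ| ≤ 1 / w θ := by
        rw [abs_div, abs_of_pos hwp]; gcongr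
      calc ‖(v' θ : ℂ) * Θ θ + ((Real.sin θ / w θ : ℝ) : ℂ) * Θ1 θ‖
          ≤ |v' θ| * ‖Θ θ‖ + |Real.sin θ / w θ| * ‖Θ1 θ‖ := by
            refine (norm_add_le _ _).trans (le_of_eq ?_)
            rw [norm_mul, norm_mul, Complex.norm_real, Complex.norm_real, Real.norm_eq_abs, Real.norm_eq_abs]
        _ ≤ 3 / w θ * M + 1 / w θ * M := by
            gcongr
            · exact h0 θ
            · exact h1 θ
        _ = 4 * M * (1 / w θ) := by ring
  have hI := int_w hρ
  rw [intervalIntegral.integral_const_mul] at b1 b2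
  calc _ ≤ M * (20 / √(1 + ρ)) + 4 * M * (20 / √(1 + ρ)) := by
        refine add_le_add (b1.trans ?_) ((key.trans b2).trans ?_) <;> gcongr
    _ = 100 * M / √(1 + ρ) := by ring

structure Ang (Θ Θ1 Θ2 : ℝ → ℂ) (M : ℝ) : Prop where
  d0 : ∀ θ, HasDerivAt Θ (Θ1 θ) θ
  d1 : ∀ θ, HasDerivAt Θ1 (Θ2 θ) θ
  c2 : Continuous Θ2
  b0 : ∀ θ, ‖Θ θ‖ ≤ M
  b1 : ∀ θ, ‖Θ1 θ‖ ≤ M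
  b2 : ∀ θ, ‖Θ2 θ‖ ≤ M

section
variable {Θ Θ1 Θ2 : ℝ → ℂ} {M : ℝ}

lemma Ang.c0 (h : Ang Θ Θ1 Θ2 M) : Continuous Θ :=
  continuous_iff_continuousAt.2 fun x => (h.d0 x).continuousAt
lemma Ang.c1 (h : Ang Θ Θ1 Θ2 M) : Continuous Θ1 :=
  continuous_iff_continuousAt.2 fun x => (h.d1 x).continuousAt

lemma sinC_deriv (θ : ℝ) : HasDerivAt (fun θ : ℝ => ((Real.sin θ : ℝ) : ℂ)) ((Real.cos θ : ℝ) : ℂ) θ :=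
  (Real.hasDerivAt_sin θ).ofReal_comp
lemma cosC_deriv (θ : ℝ) : HasDerivAt (fun θ : ℝ => ((Real.cos θ : ℝ) : ℂ)) (((-Real.sin θ : ℝ)) : ℂ) θ :=
  (Real.hasDerivAt_cos θ).ofReal_comp
lemma norm_sinC (θ : ℝ) : ‖((Real.sin θ : ℝ) : ℂ)‖ ≤ 1 := by
  rw [Complex.norm_real]; exact Real.abs_sin_le_one θ
lemma norm_cosC (θ : ℝ) : ‖((Real.cos θ : ℝ) : ℂ)‖ ≤ 1 := by
  rw [Complex.norm_real]; exact Real.abs_cos_le_one θ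

lemma nmul_le {z w : ℂ} {M : ℝ} (hz : ‖z‖ ≤ 1) (hw : ‖w‖ ≤ M) : ‖z * w‖ ≤ M := by
  rw [norm_mul]
  calc _ ≤ 1 * M := by gcongr
    _ = M := one_mul _

/-- the sine-squared integral gains a factor `ρ` -/
lemma sinsq_bound (h : Ang Θ Θ1 Θ2 M) {ρ : ℝ} (hρ : 0 ≤ ρ) (s : ℝ) :
    ‖JJ (fun θ => ((Real.sin θ : ℝ) : ℂ) * (((Real.sin θ : ℝ) : ℂ) * Θ θ)) s ρ‖ ≤
      700 * M / ((1 + ρ) * √(1 + ρ)) := by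
  have c0 := h.c0
  have c1 := h.c1
  have c2 := h.c2
  have hs : 0 < √(1 + ρ) := Real.sqrt_pos.2 (by linarith)
  have hM : 0 ≤ M := (norm_nonneg _).trans (h.b0 0)
  rw [norm_JJ_eq]
  set J := JJ (fun θ => ((Real.sin θ : ℝ) : ℂ) * (((Real.sin θ : ℝ) : ℂ) * Θ θ)) 0 ρ with hJ
  have t1 : ‖J‖ ≤ 100 * (3 * M) / √(1 + ρ) := by
    refine lemA (Θ1 := fun θ => ((Real.cos θ : ℝ) : ℂ) * (((Real.sin θ : ℝ) : ℂ) * Θ θ) +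
      ((Real.sin θ : ℝ) : ℂ) * (((Real.cos θ : ℝ) : ℂ) * Θ θ + ((Real.sin θ : ℝ) : ℂ) * Θ1 θ))
      (fun θ => (sinC_deriv θ).mul ((sinC_deriv θ).mul (h.d0 θ))) (by fun_prop) ?_ ?_ hρ 0
    · intro θ
      refine (nmul_le (norm_sinC θ) (nmul_le (norm_sinC θ) (h.b0 θ))).trans (by linarith)
    · intro θ
      have e1 := nmul_le (norm_cosC θ) (nmul_le (norm_sinC θ) (h.b0 θ))
      have e2 := nmul_le (norm_cosC θ) (h.b0 θ)
      have e3 := nmul_le (norm_sinC θ) (h.b1 θ)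
      have e4 := nmul_le (norm_sinC θ) ((norm_add_le _ _).trans (add_le_add e2 e3))
      refine (norm_add_le _ _).trans ((add_le_add e1 e4).trans (by linarith))
  set J2 := JJ (fun θ => ((Real.cos θ : ℝ) : ℂ) * Θ θ + ((Real.sin θ : ℝ) : ℂ) * Θ1 θ) 0 ρ with hJ2
  have t2 : ‖J2‖ ≤ 100 * (4 * M) / √(1 + ρ) := by
    refine lemA (Θ1 := fun θ => (((-Real.sin θ : ℝ) : ℂ) * Θ θ + ((Real.cos θ : ℝ) : ℂ) * Θ1 θ) +
      (((Real.cos θ : ℝ) : ℂ) * Θ1 θ + ((Real.sin θ : ℝ) : ℂ) * Θ2 θ))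
      (fun θ => ((cosC_deriv θ).mul (h.d0 θ)).add ((sinC_deriv θ).mul (h.d1 θ))) (by fun_prop) ?_ ?_ hρ 0
    · intro θ
      have e2 := nmul_le (norm_cosC θ) (h.b0 θ)
      have e3 := nmul_le (norm_sinC θ) (h.b1 θ)
      exact (norm_add_le _ _).trans ((add_le_add e2 e3).trans (by linarith))
    · intro θ
      have e1 : ‖((-Real.sin θ : ℝ) : ℂ) * Θ θ‖ ≤ M := nmul_le (by
        rw [Complex.ofReal_neg, norm_neg]; exact norm_sinC θ) (h.b0 θ)
      have e2 := nmul_le (norm_cosC θ) (h.b1 θ)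
      have e3 := nmul_le (norm_sinC θ) (h.b2 θ)
      refine (norm_add_le _ _).trans ((add_le_add ((norm_add_le _ _).trans (add_le_add e1 e2))
        ((norm_add_le _ _).trans (add_le_add e2 e3))).trans (by linarith))
  have t3 : (ρ : ℂ) * J = -I * J2 := by
    have hE : ∀ θ : ℝ, HasDerivAt (fun θ : ℝ => cexp (I * ((ρ * (Real.cos θ - 0) : ℝ) : ℂ)))
        (cexp (I * ((ρ * (Real.cos θ - 0) : ℝ) : ℂ)) * (I * ((ρ * (-Real.sin θ) : ℝ) : ℂ))) θ := by
      intro θ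
      exact ((((Real.hasDerivAt_cos θ).sub_const 0).const_mul ρ).ofReal_comp.const_mul I).cexp
    have ibp := intervalIntegral.integral_mul_deriv_eq_deriv_mul (a := -π) (b := π)
      (u := fun θ => ((Real.sin θ : ℝ) : ℂ) * Θ θ)
      (u' := fun θ => ((Real.cos θ : ℝ) : ℂ) * Θ θ + ((Real.sin θ : ℝ) : ℂ) * Θ1 θ)
      (fun θ _ => (sinC_deriv θ).mul (h.d0 θ)) (fun θ _ => hE θ)
      ((by fun_prop : Continuous _).intervalIntegrable _ _) ((by fun_prop : Continuous _).intervalIntegrable _ _)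
    simp only [Real.sin_neg, Real.sin_pi, neg_zero, Complex.ofReal_zero, zero_mul, zero_sub, sub_zero] at ibp
    have i1 : (∫ θ in (-π)..π, ((Real.sin θ : ℝ) : ℂ) * Θ θ * (cexp (I * ((ρ * Real.cos θ : ℝ) : ℂ)) *
        (I * ((ρ * (-Real.sin θ) : ℝ) : ℂ)))) = (-I * ρ) * J := by
      rw [hJ, JJ, ← intervalIntegral.integral_const_mul]
      congr 1; ext θ
      rw [sub_zero]; push_cast; ring
    have i2 : (∫ θ in (-π)..π, (((Real.cos θ : ℝ) : ℂ) * Θ θ + ((Real.sin θ : ℝ) : ℂ) * Θ1 θ) *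
        cexp (I * ((ρ * Real.cos θ : ℝ) : ℂ))) = J2 := by
      rw [hJ2, JJ]
      congr 1; ext θ
      rw [sub_zero]; ring
    rw [i1, i2] at ibp
    linear_combination I * ibp + (ρ : ℂ) * J * Complex.I_mul_I
  have t4 : ρ * ‖J‖ ≤ 100 * (4 * M) / √(1 + ρ) := by
    have := congrArg norm t3
    rw [norm_mul, norm_mul, Complex.norm_real, norm_neg, Complex.norm_I, one_mul, Real.norm_eq_abs, abs_of_nonneg hρ] at this
    rw [this]; exact t2
  rw [le_div_iff₀ (by positivity)]
  rw [le_div_iff₀ hs] at t1 t4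
  nlinarith

noncomputable def aS (Θ : ℝ → ℂ) (s : ℝ) : ℝ → ℂ :=
  JJ (fun θ => (((1 + s * Real.cos θ) / 2 : ℝ) : ℂ) * Θ θ) s
noncomputable def aS' (Θ : ℝ → ℂ) (s : ℝ) (ρ : ℝ) : ℂ :=
  -(I * s / 2) * JJ (fun θ => ((Real.sin θ : ℝ) : ℂ) * (((Real.sin θ : ℝ) : ℂ) * Θ θ)) s ρ

lemma aS_amp (h : Ang Θ Θ1 Θ2 M) {s : ℝ} (hs : s = 1 ∨ s = -1) : Amp (aS Θ s) (aS' Θ s) (400 * M) := by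
  have c0 := h.c0
  have c1 := h.c1
  have hM : 0 ≤ M := (norm_nonneg _).trans (h.b0 0)
  have hs2 : s * s = 1 := by rcases hs with rfl | rfl <;> norm_num
  have hsa : |s| = 1 := by rcases hs with rfl | rfl <;> norm_num
  refine ⟨?_, ?_, ?_, ?_⟩
  · intro ρ
    refine (JJ_deriv (by fun_prop) s ρ).congr_deriv ?_
    rw [aS', JJ, JJ, ← intervalIntegral.integral_const_mul]
    congr 1; ext θ
    have e : (Real.cos θ - s) * ((1 + s * Real.cos θ) / 2) = -(s / 2) * (Real.sin θ * Real.sin θ) := by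
      have := Real.sin_sq_add_cos_sq θ
      linear_combination (-Real.cos θ/2) * hs2 + (s / 2) * this
    have e2 := congrArg (fun r : ℝ => (r : ℂ)) e
    simp only [Complex.ofReal_mul, Complex.ofReal_neg, Complex.ofReal_div, Complex.ofReal_ofNat] at e2 ⊢
    linear_combination (I * cexp (I * (ρ * ((Real.cos θ - s : ℝ) : ℂ))) * Θ θ) * e2
  · have : Continuous (JJ (fun θ => ((Real.sin θ : ℝ) : ℂ) * (((Real.sin θ : ℝ) : ℂ) * Θ θ)) s) :=
      continuous_iff_continuousAt.2 fun x => (JJ_deriv (by fun_prop) s x).continuousAt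
    unfold aS'
    fun_prop
  · intro ρ hρ
    have hcos : ∀ θ, ‖(((1 + s * Real.cos θ) / 2 : ℝ) : ℂ)‖ ≤ 1 := by
      intro θ
      rw [Complex.norm_real, Real.norm_eq_abs, abs_le]
      have := Real.neg_one_le_cos θ
      have := Real.cos_le_one θ
      rcases hs with rfl | rfl <;> constructor <;> linarith
    have hsin : ∀ θ, ‖((s * -Real.sin θ / 2 : ℝ) : ℂ)‖ ≤ 1 := by
      intro θ
      rw [Complex.norm_real, Real.norm_eq_abs, abs_le]
      have := Real.neg_one_le_sin θ
      have := Real.sin_le_one θ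
      rcases hs with rfl | rfl <;> constructor <;> linarith
    have := lemA (Θ := fun θ => (((1 + s * Real.cos θ) / 2 : ℝ) : ℂ) * Θ θ)
      (Θ1 := fun θ => ((s * -Real.sin θ / 2 : ℝ) : ℂ) * Θ θ + (((1 + s * Real.cos θ) / 2 : ℝ) : ℂ) * Θ1 θ)
      (M := 2 * M)
      (fun θ => ((((Real.hasDerivAt_cos θ).const_mul s).const_add 1).div_const 2).ofReal_comp.mul (h.d0 θ))
      (by fun_prop)
      (fun θ => (nmul_le (hcos θ) (h.b0 θ)).trans (by linarith))
      (fun θ => (norm_add_le _ _).trans ((add_le_add (nmul_le (hsin θ) (h.b0 θ))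
        (nmul_le (hcos θ) (h.b1 θ))).trans (by linarith))) hρ s
    exact this.trans (div_le_div_of_nonneg_right (by linarith) (Real.sqrt_nonneg _))
  · intro ρ hρ
    have := sinsq_bound h hρ s
    have hs0 : 0 < √(1 + ρ) := Real.sqrt_pos.2 (by linarith)
    rw [aS', norm_mul]
    have e : ‖-(I * (s : ℂ) / 2)‖ = 1 / 2 := by
      rw [norm_neg, norm_div, norm_mul, Complex.norm_I, Complex.norm_real, Real.norm_eq_abs, hsa]; simp
    rw [e]
    calc 1 / 2 * _ ≤ 1 / 2 * (700 * M / ((1 + ρ) * √(1 + ρ))) := by gcongr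
      _ = 350 * M / ((1 + ρ) * √(1 + ρ)) := by ring
      _ ≤ _ := by gcongr; linarith

lemma JJ_decomp (hΘ : Continuous Θ) (ρ : ℝ) :
    JJ Θ 0 ρ = cexp (I * ((ρ : ℝ) : ℂ)) * aS Θ 1 ρ + cexp (I * ((-ρ : ℝ) : ℂ)) * aS Θ (-1) ρ := by
  rw [aS, aS, JJ_zero_eq _ 1, JJ_zero_eq _ (-1), ← mul_assoc, ← mul_assoc, ← Complex.exp_add, ← Complex.exp_add]
  have e1 : I * ((ρ : ℝ) : ℂ) + I * ((-(ρ * 1) : ℝ) : ℂ) = 0 := by push_cast; ring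
  have e2 : I * ((-ρ : ℝ) : ℂ) + I * ((-(ρ * -1) : ℝ) : ℂ) = 0 := by push_cast; ring
  rw [e1, e2, Complex.exp_zero, one_mul, one_mul, JJ, JJ, JJ, ← intervalIntegral.integral_add]
  · congr 1; ext θ
    push_cast; ring
  · exact (by fun_prop : Continuous _).intervalIntegrable _ _
  · exact (by fun_prop : Continuous _).intervalIntegrable _ _

lemma Amp.conj {a a' : ℝ → ℂ} {K : ℝ} (h : Amp a a' K) :
    Amp (fun x => (starRingEnd ℂ) (a x)) (fun x => (starRingEnd ℂ) (a' x)) K := by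
  refine ⟨fun ρ => ?_, ?_, fun ρ hρ => ?_, fun ρ hρ => ?_⟩
  · exact (h.hd ρ).star
  · exact Complex.continuous_conj.comp h.hc
  · rw [Complex.norm_conj]; exact h.h0 ρ hρ
  · rw [Complex.norm_conj]; exact h.h1 ρ hρ

lemma osc_FF' {a a' : ℝ → ℂ} {K : ℝ} (h : Amp a a' K) {T : ℝ} (ρ : ℝ) (hT : T ≠ 0) :
    ‖∫ x in Set.Ioi (0 : ℝ), FF a T ρ x‖ ≤ 600 * K / |T| := by
  rcases lt_or_gt_of_ne hT with h1 | h1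
  · have := osc_FF h.conj (T := -T) (-ρ) (by linarith)
    rw [abs_of_neg h1]
    refine le_trans (le_of_eq ?_) this
    rw [← Complex.norm_conj, ← integral_conj]
    congr 2; ext x
    rw [FF, FF, map_mul, map_mul, ← Complex.exp_conj, map_mul, Complex.conj_I, Complex.conj_ofReal,
      Complex.conj_ofReal, abs_neg]
    congr 3
    push_cast; ring
  · rw [abs_of_pos h1]; exact osc_FF h ρ h1

lemma FF_int {a a' : ℝ → ℂ} {K : ℝ} (h : Amp a a' K) (T ρ : ℝ) : IntegrableOn (FF a T ρ) (Set.Ioi 0) := by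
  have hK := h.K_nonneg
  refine (gg_integrable.mul_const K).mono' (FF_cont h T ρ).aestronglyMeasurable ?_
  filter_upwards [ae_restrict_mem measurableSet_Ioi] with x hx
  have hx0 : (0 : ℝ) < x := hx
  rw [FF, norm_mul, norm_mul, norm_cexp_I_mul, Complex.norm_real, Real.norm_eq_abs, one_mul,
    abs_of_nonneg (gg_nonneg hx0.le)]
  have hp : 0 ≤ |ρ| * x := by positivity
  refine mul_le_mul_of_nonneg_left ((h.h0 _ hp).trans ?_) (gg_nonneg hx0.le)
  exact div_le_self hK (Real.one_le_sqrt.2 (by linarith))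

lemma radial_bound (h : Ang Θ Θ1 Θ2 M) {T R : ℝ} (hT : T ≠ 0) (hR : 0 ≤ R) :
    ‖∫ x in Set.Ioi (0 : ℝ), cexp (I * ((T * phB x : ℝ) : ℂ)) * (gg x : ℂ) * JJ Θ 0 (R * x)‖ ≤
      480000 * M / |T| := by
  have hp := aS_amp h (s := 1) (Or.inl rfl)
  have hm := aS_amp h (s := -1) (Or.inr rfl)
  have e : (∫ x in Set.Ioi (0 : ℝ), cexp (I * ((T * phB x : ℝ) : ℂ)) * (gg x : ℂ) * JJ Θ 0 (R * x)) =
      (∫ x in Set.Ioi (0 : ℝ), FF (aS Θ 1) T (-R) x) + ∫ x in Set.Ioi (0 : ℝ), FF (aS Θ (-1)) T R x := by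
    rw [← integral_add (FF_int hp T (-R)) (FF_int hm T R)]
    congr 1; ext x
    rw [FF, FF, JJ_decomp h.c0, abs_neg, abs_of_nonneg hR]
    have e1 : I * ((T * phB x - -R * x : ℝ) : ℂ) = I * ((T * phB x : ℝ) : ℂ) + I * ((R * x : ℝ) : ℂ) := by
      push_cast; ring
    have e2 : I * ((T * phB x - R * x : ℝ) : ℂ) = I * ((T * phB x : ℝ) : ℂ) + I * ((-(R * x) : ℝ) : ℂ) := by
      push_cast; ring
    rw [e1, e2, Complex.exp_add, Complex.exp_add]
    ring
  rw [e]
  refine (norm_add_le _ _).trans ((add_le_add (osc_FF' hp _ hT) (osc_FF' hm _ hT)).trans (le_of_eq ?_))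
  ring

end

noncomputable def Th (γ : Fin 2 → ℕ) (θ : ℝ) : ℂ :=
  (I * ((Real.cos θ : ℝ) : ℂ)) ^ γ 0 * (I * ((Real.sin θ : ℝ) : ℂ)) ^ γ 1

lemma Th_per (γ : Fin 2 → ℕ) : Function.Periodic (Th γ) (2 * π) := by
  intro θ; simp [Th]

lemma per_bdd {f : ℝ → ℂ} (hc : Continuous f) (hp : Function.Periodic f (2 * π)) :
    ∃ M, ∀ θ, ‖f θ‖ ≤ M := by
  obtain ⟨M, hM⟩ := (isCompact_Icc (a := (0 : ℝ)) (b := 2 * π)).exists_bound_of_continuousOn hc.continuousOn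
  refine ⟨M, fun θ => ?_⟩
  obtain ⟨y, hy, e⟩ := hp.exists_mem_Ico₀ (by positivity) θ
  rw [e]; exact hM y ⟨hy.1, hy.2.le⟩

lemma per_deriv {f : ℝ → ℂ} {c : ℝ} (hp : Function.Periodic f c) : Function.Periodic (deriv f) c := by
  intro x
  rw [← deriv_comp_add_const]
  congr 1; ext y; exact hp y

lemma Th_ang (γ : Fin 2 → ℕ) : ∃ M, ∀ α, Ang (fun θ => Th γ (θ + α)) (fun θ => deriv (Th γ) (θ + α))
    (fun θ => deriv (deriv (Th γ)) (θ + α)) M := by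
  have hcd : ContDiff ℝ (2 : ℕ) (Th γ) := by
    unfold Th
    have h1 : ContDiff ℝ (2 : ℕ) fun θ : ℝ => ((Real.cos θ : ℝ) : ℂ) := Complex.ofRealCLM.contDiff.comp Real.contDiff_cos
    have h2 : ContDiff ℝ (2 : ℕ) fun θ : ℝ => ((Real.sin θ : ℝ) : ℂ) := Complex.ofRealCLM.contDiff.comp Real.contDiff_sin
    exact ((contDiff_const.mul h1).pow _).mul ((contDiff_const.mul h2).pow _)
  have hcd1 : ContDiff ℝ (1 : ℕ) (deriv (Th γ)) := by
    have := (contDiff_succ_iff_deriv (n := ((1 : ℕ) : WithTop ℕ∞)) (f := Th γ)).1 (by exact_mod_cast hcd)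
    exact this.2.2
  have c2 : Continuous (deriv (deriv (Th γ))) := hcd1.continuous_deriv (by simp)
  obtain ⟨M0, h0⟩ := per_bdd hcd.continuous (Th_per γ)
  obtain ⟨M1, h1⟩ := per_bdd hcd1.continuous (per_deriv (Th_per γ))
  obtain ⟨M2, h2⟩ := per_bdd c2 (per_deriv (per_deriv (Th_per γ)))
  refine ⟨max M0 (max M1 M2), fun α => ⟨?_, ?_, ?_, ?_, ?_, ?_⟩⟩
  · intro θ
    exact HasDerivAt.comp_add_const θ α ((hcd.differentiable (by simp)).differentiableAt.hasDerivAt)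
  · intro θ
    exact HasDerivAt.comp_add_const θ α ((hcd1.differentiable (by simp)).differentiableAt.hasDerivAt)
  · fun_prop
  · exact fun θ => (h0 _).trans (le_max_left _ _)
  · exact fun θ => (h1 _).trans ((le_max_left _ _).trans (le_max_right _ _))
  · exact fun θ => (h2 _).trans ((le_max_right _ _).trans (le_max_right _ _))

lemma int_polar (F : EuclideanSpace ℝ (Fin 2) → ℂ) :
    ∫ ξ, F ξ = ∫ p in Set.Ioi (0 : ℝ) ×ˢ Set.Ioo (-π) π,
      (p.1 : ℂ) * F (!₂[p.1 * Real.cos p.2, p.1 * Real.sin p.2]) := by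
  have h1 := (PiLp.volume_preserving_toLp (Fin 2)).integral_comp
    (MeasurableEquiv.toLp 2 (Fin 2 → ℝ)).measurableEmbedding F
  have h2 := ((volume_preserving_finTwoArrow ℝ).symm).integral_comp
    (MeasurableEquiv.finTwoArrow (α := ℝ)).symm.measurableEmbedding (fun y => F (WithLp.toLp 2 y))
  rw [← h1, ← h2, ← integral_comp_polarCoord_symm]
  rfl

lemma polar_z (z : EuclideanSpace ℝ (Fin 2)) : ∃ R α : ℝ, 0 ≤ R ∧ z 0 = R * Real.cos α ∧ z 1 = R * Real.sin α := by
  set w : ℂ := ⟨z 0, z 1⟩ with hw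
  refine ⟨‖w‖, Complex.arg w, norm_nonneg _, ?_, ?_⟩
  · rw [Complex.norm_mul_cos_arg]
  · rw [Complex.norm_mul_sin_arg]

noncomputable def Kern (σ τ μ : ℝ) (γ : Fin 2 → ℕ) (z : EuclideanSpace ℝ (Fin 2)) : ℂ :=
  ∫ ξ : EuclideanSpace ℝ (Fin 2), cexp (I * (⟪z, ξ⟫_ℝ : ℂ)) * (prop2 σ τ μ ξ * rieszSym γ ξ *
    ((((1 + μ * ‖ξ‖ ^ 2) ^ 2)⁻¹ : ℝ) : ℂ))

lemma scale_int {c μ : ℝ} (hc : 0 < c) (hμ : μ * c ^ 2 = 3) :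
    IntegrableOn (fun r => r / (1 + μ * r ^ 2) ^ 2) (Set.Ioi 0) := by
  have := (integrableOn_Ioi_comp_mul_left_iff (fun r => r / (1 + μ * r ^ 2) ^ 2) 0 hc).1
  rw [mul_zero] at this
  apply this
  refine (gg_integrable.const_mul c).congr (Filter.Eventually.of_forall fun x => ?_)
  simp only [gg]
  rw [← mul_div_assoc]
  congr 3
  linear_combination (-x ^ 2) * hμ

lemma Kern_bound {M : ℝ} {γ : Fin 2 → ℕ} (hM : ∀ α, Ang (fun θ => Th γ (θ + α)) (fun θ => deriv (Th γ) (θ + α))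
    (fun θ => deriv (deriv (Th γ)) (θ + α)) M) {σ τ μ c : ℝ} (hστ : σ * τ ≠ 0) (hc : 0 < c) (hμ0 : 0 < μ)
    (hμ : μ * c ^ 2 = 3) (z : EuclideanSpace ℝ (Fin 2)) :
    ‖Kern σ τ μ γ z‖ ≤ 480000 * M * c / |σ * τ| := by
  obtain ⟨R, α, hR, hz0, hz1⟩ := polar_z z
  have hThc : Continuous (Th γ) := by unfold Th; fun_prop
  have s1 : Kern σ τ μ γ z = ∫ p in Set.Ioi (0 : ℝ) ×ˢ Set.Ioo (-π) π,
      (cexp (I * ((σ * τ * p.1 / √(1 + μ * p.1 ^ 2 / 3) : ℝ) : ℂ)) * ((p.1 / (1 + μ * p.1 ^ 2) ^ 2 : ℝ) : ℂ)) *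
      (cexp (I * ((R * p.1 * (Real.cos (p.2 - α)) : ℝ) : ℂ)) * Th γ p.2) := by
    rw [Kern, int_polar]
    refine setIntegral_congr_fun (measurableSet_Ioi.prod measurableSet_Ioo) ?_
    rintro ⟨r, θ⟩ ⟨hr, hθ⟩
    have hr0 : 0 < r := hr
    have hn : ‖(!₂[r * Real.cos θ, r * Real.sin θ] : EuclideanSpace ℝ (Fin 2))‖ = r := by
      rw [EuclideanSpace.norm_eq]
      simp only [Fin.sum_univ_two, Real.norm_eq_abs, sq_abs]
      rw [show ![r * Real.cos θ, r * Real.sin θ] 0 = r * Real.cos θ from rfl,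
        show ![r * Real.cos θ, r * Real.sin θ] 1 = r * Real.sin θ from rfl]
      rw [show (r * Real.cos θ) ^ 2 + (r * Real.sin θ) ^ 2 = r ^ 2 by
        linear_combination r ^ 2 * Real.sin_sq_add_cos_sq θ]
      exact Real.sqrt_sq hr0.le
    have hi : ⟪z, (!₂[r * Real.cos θ, r * Real.sin θ] : EuclideanSpace ℝ (Fin 2))⟫_ℝ = R * r * Real.cos (θ - α) := by
      rw [PiLp.inner_apply]
      simp only [Fin.sum_univ_two, RCLike.inner_apply, conj_trivial]
      rw [show ![r * Real.cos θ, r * Real.sin θ] 0 = r * Real.cos θ from rfl,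
        show ![r * Real.cos θ, r * Real.sin θ] 1 = r * Real.sin θ from rfl,
        hz0, hz1, Real.cos_sub]
      ring
    have hrs : rieszSym γ (!₂[r * Real.cos θ, r * Real.sin θ] : EuclideanSpace ℝ (Fin 2)) = Th γ θ := by
      rw [rieszSym, hn, Fin.prod_univ_two, Fin.sum_univ_two, Th]
      rw [show (!₂[r * Real.cos θ, r * Real.sin θ] : EuclideanSpace ℝ (Fin 2)) 0 = r * Real.cos θ from rfl,
        show (!₂[r * Real.cos θ, r * Real.sin θ] : EuclideanSpace ℝ (Fin 2)) 1 = r * Real.sin θ from rfl]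
      have : (r : ℂ) ≠ 0 := by exact_mod_cast hr0.ne'
      rw [div_eq_iff (by exact_mod_cast (pow_pos hr0 _).ne')]
      push_cast
      simp only [mul_pow, pow_add]
      ring
    simp only
    rw [prop2, hn, hi, hrs]
    push_cast
    ring
  have e2 : ∀ r : ℝ, ∫ θ in Set.Ioo (-π) π, cexp (I * ((R * r * (Real.cos (θ - α)) : ℝ) : ℂ)) * Th γ θ =
      JJ (fun θ => Th γ (θ + α)) 0 (R * r) := by
    intro r
    rw [← integral_Ioc_eq_integral_Ioo, ← intervalIntegral.integral_of_le (by linarith [Real.pi_pos])]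
    have hp : Function.Periodic (fun θ => cexp (I * ((R * r * (Real.cos (θ - α)) : ℝ) : ℂ)) * Th γ θ) (2 * π) := by
      intro θ
      have := Th_per γ θ
      simp only [this]
      rw [show θ + 2 * π - α = (θ - α) + 2 * π by ring, Real.cos_add_two_pi]
    have h1 := hp.intervalIntegral_add_eq (-π) (-π + α)
    rw [show -π + 2 * π = π by ring, show -π + α + 2 * π = π + α by ring] at h1
    rw [h1, JJ, ← intervalIntegral.integral_comp_add_right]
    congr 1; ext θ
    rw [add_sub_cancel_right, sub_zero]
  have s2 : Kern σ τ μ γ z = ∫ r in Set.Ioi (0 : ℝ),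
      (cexp (I * ((σ * τ * r / √(1 + μ * r ^ 2 / 3) : ℝ) : ℂ)) * ((r / (1 + μ * r ^ 2) ^ 2 : ℝ) : ℂ)) *
      JJ (fun θ => Th γ (θ + α)) 0 (R * r) := by
    rw [s1, Measure.volume_eq_prod, setIntegral_prod]
    · congr 1; ext r
      simp only
      rw [integral_const_mul, e2 r]
    · have hb : Integrable (fun p : ℝ × ℝ => (p.1 / (1 + μ * p.1 ^ 2) ^ 2) * M)
          ((volume.restrict (Set.Ioi (0 : ℝ))).prod (volume.restrict (Set.Ioo (-π) π))) :=
        Integrable.mul_prod (scale_int hc hμ) (g := fun _ => M) (integrable_const M)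
      rw [IntegrableOn, ← Measure.prod_restrict]
      refine hb.mono' ?_ ?_
      · have m1 : Measurable (Th γ) := hThc.measurable
        refine Measurable.aestronglyMeasurable ?_
        fun_prop
      · rw [Measure.prod_restrict]
        filter_upwards [ae_restrict_mem (measurableSet_Ioi.prod measurableSet_Ioo)] with p hp
        have hp0 : 0 < p.1 := hp.1
        rw [norm_mul, norm_mul, norm_mul, norm_cexp_I_mul, norm_cexp_I_mul, one_mul, one_mul, Complex.norm_real,
          Real.norm_eq_abs, abs_of_nonneg (by positivity)]
        gcongr
        simpa using (hM 0).b0 p.2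
  have s3 : Kern σ τ μ γ z = (c * c : ℝ) * ∫ x in Set.Ioi (0 : ℝ), cexp (I * ((σ * τ * c * phB x : ℝ) : ℂ)) * (gg x : ℂ) *
      JJ (fun θ => Th γ (θ + α)) 0 (R * c * x) := by
    have := integral_comp_mul_left_Ioi (fun r => (cexp (I * ((σ * τ * r / √(1 + μ * r ^ 2 / 3) : ℝ) : ℂ)) *
      ((r / (1 + μ * r ^ 2) ^ 2 : ℝ) : ℂ)) * JJ (fun θ => Th γ (θ + α)) 0 (R * r)) 0 hc
    rw [mul_zero, eq_inv_smul_iff₀ hc.ne'] at this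
    rw [s2, ← this, Complex.real_smul, Complex.ofReal_mul, mul_assoc (c : ℂ)]
    congr 1
    rw [← integral_const_mul (c : ℂ)]
    refine setIntegral_congr_fun measurableSet_Ioi fun x _ => ?_
    have h3 : μ * (c * x) ^ 2 = 3 * x ^ 2 := by linear_combination x ^ 2 * hμ
    rw [h3, show 1 + 3 * x ^ 2 / 3 = 1 + x ^ 2 by ring, phB, gg, AA, mul_assoc R,
      show σ * τ * (c * x) / √(1 + x ^ 2) = σ * τ * c * (x / √(1 + x ^ 2)) by ring]
    push_cast
    ring
  have rb := radial_bound (hM α) (T := σ * τ * c) (R := R * c) (mul_ne_zero hστ hc.ne') (by positivity)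
  rw [s3, norm_mul, Complex.norm_real, Real.norm_eq_abs, abs_of_pos (by positivity)]
  rw [abs_mul (σ * τ), abs_of_pos hc] at rb
  have : 0 < |σ * τ| := abs_pos.2 hστ
  calc _ ≤ c * c * (480000 * M / (|σ * τ| * c)) := by gcongr
    _ = _ := by field_simp

section
open scoped FourierTransform

lemma cst2 : (((2 * π) ^ (-((2 : ℕ) : ℝ) / 2) : ℝ) : ℂ) = (2 * π : ℂ)⁻¹ := by
  rw [show (-((2 : ℕ) : ℝ) / 2) = -1 by norm_num, Real.rpow_neg_one]
  push_cast; rfl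

lemma riesz_le (γ : Fin 2 → ℕ) (ξ : (EuclideanSpace ℝ (Fin 2))) : ‖rieszSym γ ξ‖ ≤ 1 := by
  rw [rieszSym, norm_div, Complex.norm_real, norm_prod, Real.norm_eq_abs, abs_of_nonneg (by positivity)]
  refine div_le_one_of_le₀ ?_ (by positivity)
  rw [← Finset.prod_pow_eq_pow_sum]
  refine Finset.prod_le_prod (fun i _ => norm_nonneg _) fun i _ => ?_
  rw [norm_pow, norm_mul, Complex.norm_I, one_mul, Complex.norm_real]
  gcongr
  exact PiLp.norm_apply_le ξ i

lemma winv_int {μ : ℝ} (hμ0 : 0 < μ) (hμ1 : μ ≤ 1) :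
    Integrable (fun ξ : (EuclideanSpace ℝ (Fin 2)) => ((1 + μ * ‖ξ‖ ^ 2) ^ 2)⁻¹) := by
  have h := (integrable_rpow_neg_one_add_norm_sq (E := (EuclideanSpace ℝ (Fin 2))) (μ := volume) (r := 4) (by simp; norm_num)).const_mul (μ ^ 2)⁻¹
  refine h.mono' ?_ ?_
  · refine Continuous.aestronglyMeasurable ?_
    exact Continuous.inv₀ (by fun_prop) (fun x => by positivity)
  · refine Filter.Eventually.of_forall fun ξ => ?_
    rw [Real.norm_eq_abs, abs_of_nonneg (by positivity), show (-4 / 2 : ℝ) = -((2 : ℕ) : ℝ) by norm_num,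
      Real.rpow_neg (by positivity), Real.rpow_natCast, ← mul_inv, ← mul_pow]
    gcongr
    nlinarith [sq_nonneg ‖ξ‖]

lemma ft_eq (f : SchwartzMap (EuclideanSpace ℝ (Fin 2)) ℂ) (ξ : (EuclideanSpace ℝ (Fin 2))) : ft f ξ = (2 * π : ℂ)⁻¹ * 𝓕 (f : (EuclideanSpace ℝ (Fin 2)) → ℂ) ((2 * π)⁻¹ • ξ) := by
  rw [ft, cst2, Real.fourier_eq']
  congr 2; ext v
  rw [smul_eq_mul, inner_smul_right]
  congr 2
  push_cast
  have : (π : ℂ) ≠ 0 := by exact_mod_cast Real.pi_ne_zero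
  field_simp

lemma main_fourier (f : SchwartzMap (EuclideanSpace ℝ (Fin 2)) ℂ) {μ : ℝ} (hμ0 : 0 < μ) (hμ1 : μ ≤ 1) {m : (EuclideanSpace ℝ (Fin 2)) → ℂ} (hm : Measurable m)
    (hm1 : ∀ ξ, ‖m ξ‖ ≤ 1) {B : ℝ}
    (hB : ∀ z : (EuclideanSpace ℝ (Fin 2)), ‖∫ ξ : (EuclideanSpace ℝ (Fin 2)), cexp (I * (⟪z, ξ⟫_ℝ : ℂ)) * (m ξ * ((((1 + μ * ‖ξ‖ ^ 2) ^ 2)⁻¹ : ℝ) : ℂ))‖ ≤ B) :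
    eLpNorm (fmult m f) ⊤ volume ≤ ENNReal.ofReal B *
      eLpNorm (fmult (fun ξ => (((1 + μ * ‖ξ‖ ^ 2) ^ 2 : ℝ) : ℂ)) f) 1 volume := by
  have hpi : (π : ℂ) ≠ 0 := by exact_mod_cast Real.pi_ne_zero
  have hB0 : 0 ≤ B := (norm_nonneg _).trans (hB 0)
  set W : (EuclideanSpace ℝ (Fin 2)) → ℂ := fun η => (((1 + μ * (‖(2 * π) • η‖ ^ 2)) ^ 2 : ℝ) : ℂ) with hW
  have hWg : W.HasTemperateGrowth := by
    have e : W = fun η => (((1 + (μ * (2 * π) ^ 2) * (‖η‖ ^ 2)) ^ 2 : ℝ) : ℂ) := by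
      ext η
      simp only [hW, norm_smul, Real.norm_eq_abs, mul_pow, sq_abs]
      congr 3; ring
    rw [e]
    fun_prop
  set g : SchwartzMap (EuclideanSpace ℝ (Fin 2)) ℂ := SchwartzMap.smulLeftCLM ℂ W (𝓕 f) with hg
  have hgv : ∀ η, g η = W η * 𝓕 (f : (EuclideanSpace ℝ (Fin 2)) → ℂ) η := by
    intro η
    rw [hg, SchwartzMap.smulLeftCLM_apply_apply hWg]
    rfl
  set G : SchwartzMap (EuclideanSpace ℝ (Fin 2)) ℂ := 𝓕⁻ g with hG
  have hgG : ∀ η, g η = 𝓕 (G : (EuclideanSpace ℝ (Fin 2)) → ℂ) η := by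
    intro η
    have : 𝓕 G = g := by rw [hG]; exact FourierTransform.fourier_fourierInv_eq g
    rw [← this]; rfl
  have hGg : ∀ x, G x = 𝓕⁻ (g : (EuclideanSpace ℝ (Fin 2)) → ℂ) x := by
    intro x
    rw [hG, SchwartzMap.fourierInv_coe]
  have hGint : Integrable (G : (EuclideanSpace ℝ (Fin 2)) → ℂ) := G.integrable
  -- weighted multiplier equals G
  have e1 : fmult (fun ξ => (((1 + μ * ‖ξ‖ ^ 2) ^ 2 : ℝ) : ℂ)) f = G := by
    ext x
    rw [hGg, Real.fourierInv_eq', fmult, cst2]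
    have := Measure.integral_comp_smul (μ := (volume : Measure (EuclideanSpace ℝ (Fin 2))))
      (fun ξ => cexp (I * (⟪x, ξ⟫_ℝ : ℂ)) * (((1 + μ * ‖ξ‖ ^ 2) ^ 2 : ℝ) : ℂ) * ft f ξ) (2 * π)
    rw [finrank_euclideanSpace_fin, abs_of_pos (by positivity)] at this
    have h2 : (∫ ξ, cexp (I * (⟪x, ξ⟫_ℝ : ℂ)) * (((1 + μ * ‖ξ‖ ^ 2) ^ 2 : ℝ) : ℂ) * ft f ξ) =
      (2 * π : ℂ) ^ 2 * ∫ η : (EuclideanSpace ℝ (Fin 2)), cexp (I * (⟪x, (2 * π) • η⟫_ℝ : ℂ)) *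
        (((1 + μ * ‖(2 * π) • η‖ ^ 2) ^ 2 : ℝ) : ℂ) * ft f ((2 * π) • η) := by
      rw [this, Complex.real_smul, ← mul_assoc]
      push_cast
      field_simp
    rw [h2, ← mul_assoc, ← integral_const_mul]
    congr 1; ext η
    rw [ft_eq, smul_smul, inv_mul_cancel₀ (by positivity), one_smul, hgv, smul_eq_mul, real_inner_comm, inner_smul_left]
    simp only [hW, conj_trivial]
    rw [mul_comm I]
    field_simp
  have e2 : ∀ x, fmult m f x = ((2 * π : ℂ) ^ 2)⁻¹ * ∫ v, G v *
      ∫ ξ : (EuclideanSpace ℝ (Fin 2)), cexp (I * (⟪x - v, ξ⟫_ℝ : ℂ)) * (m ξ * ((((1 + μ * ‖ξ‖ ^ 2) ^ 2)⁻¹ : ℝ) : ℂ)) := by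
    intro x
    have hft : ∀ ξ, ft f ξ = (2 * π : ℂ)⁻¹ * ((((1 + μ * ‖ξ‖ ^ 2) ^ 2)⁻¹ : ℝ) : ℂ) *
        ∫ v, cexp (-(I * (⟪v, ξ⟫_ℝ : ℂ))) * G v := by
      intro ξ
      have h1 := hgv ((2 * π)⁻¹ • ξ)
      rw [hgG, Real.fourier_eq'] at h1
      have h2 : (∫ v, cexp (-(I * (⟪v, ξ⟫_ℝ : ℂ))) * G v) = W ((2 * π)⁻¹ • ξ) * 𝓕 (f : (EuclideanSpace ℝ (Fin 2)) → ℂ) ((2 * π)⁻¹ • ξ) := by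
        rw [← h1]
        congr 1; ext v
        rw [smul_eq_mul, inner_smul_right]
        congr 2
        push_cast
        field_simp
      have h3 : W ((2 * π)⁻¹ • ξ) = (((1 + μ * ‖ξ‖ ^ 2) ^ 2 : ℝ) : ℂ) := by
        simp only [hW]
        rw [smul_smul, mul_inv_cancel₀ (by positivity), one_smul]
      have h4 : (((1 + μ * ‖ξ‖ ^ 2) ^ 2 : ℝ) : ℂ) ≠ 0 := by
        have : (1 + μ * ‖ξ‖ ^ 2) ^ 2 ≠ 0 := by positivity
        exact_mod_cast this
      rw [h2, h3, ft_eq, Complex.ofReal_inv, mul_assoc, inv_mul_cancel_left₀ h4]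
    have hInt : Integrable (fun p : (EuclideanSpace ℝ (Fin 2)) × (EuclideanSpace ℝ (Fin 2)) => G p.2 * (cexp (I * (⟪x - p.2, p.1⟫_ℝ : ℂ)) *
        (m p.1 * ((((1 + μ * ‖p.1‖ ^ 2) ^ 2)⁻¹ : ℝ) : ℂ)))) (volume.prod volume) := by
      refine (Integrable.mul_prod (winv_int hμ0 hμ1) hGint.norm).mono' ?_ ?_
      · have hGm : Measurable (G : (EuclideanSpace ℝ (Fin 2)) → ℂ) := G.continuous.measurable
        refine Measurable.aestronglyMeasurable ?_
        have : Measurable fun p : (EuclideanSpace ℝ (Fin 2)) × (EuclideanSpace ℝ (Fin 2)) => (⟪x - p.2, p.1⟫_ℝ : ℝ) := 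
          (by fun_prop : Continuous fun p : (EuclideanSpace ℝ (Fin 2)) × (EuclideanSpace ℝ (Fin 2)) => (⟪x - p.2, p.1⟫_ℝ : ℝ)).measurable
        have : Measurable fun p : (EuclideanSpace ℝ (Fin 2)) × (EuclideanSpace ℝ (Fin 2)) => ((⟪x - p.2, p.1⟫_ℝ : ℝ) : ℂ) := by fun_prop
        fun_prop
      · refine Filter.Eventually.of_forall fun p => ?_
        rw [norm_mul, norm_mul, norm_mul, norm_cexp_I_mul, one_mul, Complex.norm_real, Real.norm_eq_abs,
          abs_of_nonneg (by positivity), mul_comm]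
        gcongr
        exact mul_le_of_le_one_left (by positivity) (hm1 _)
    simp only [← integral_const_mul]
    rw [integral_integral_swap (f := fun v ξ => ((2 * π : ℂ) ^ 2)⁻¹ * (G v * (cexp (I * (⟪x - v, ξ⟫_ℝ : ℂ)) *
        (m ξ * ((((1 + μ * ‖ξ‖ ^ 2) ^ 2)⁻¹ : ℝ) : ℂ))))) ?_]
    · rw [fmult, cst2, ← integral_const_mul]
      congr 1; ext ξ
      rw [hft, ← mul_assoc, ← mul_assoc, ← integral_const_mul]
      congr 1; ext v
      rw [inner_sub_left, Complex.ofReal_sub, mul_sub, sub_eq_add_neg, Complex.exp_add]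
      field_simp
    · exact (hInt.const_mul _).swap
  have hpt : ∀ x, ‖fmult m f x‖ ≤ B * ∫ v, ‖G v‖ := by
    intro x
    rw [e2, norm_mul, norm_inv, norm_pow]
    have h1 : ‖(2 * π : ℂ)‖ = 2 * π := by
      rw [norm_mul, Complex.norm_real, Real.norm_eq_abs, abs_of_pos Real.pi_pos]; simp
    have h2 : ((2 * π) ^ 2)⁻¹ ≤ 1 := inv_le_one_of_one_le₀ (by nlinarith [Real.pi_gt_three])
    rw [h1]
    refine (mul_le_of_le_one_left (norm_nonneg _) h2).trans ?_
    rw [← integral_const_mul]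
    refine norm_integral_le_of_norm_le (hGint.norm.const_mul B) (Filter.Eventually.of_forall fun v => ?_)
    rw [norm_mul, mul_comm]
    gcongr
    exact hB _
  rw [e1, eLpNorm_one_eq_lintegral_enorm, ← ofReal_integral_norm_eq_lintegral_enorm hGint,
    ← ENNReal.ofReal_mul hB0, eLpNorm_exponent_top]
  exact eLpNormEssSup_le_of_ae_bound (Filter.Eventually.of_forall hpt)

end

theorem stmt16 (σ : ℝ) (hσ : σ = 1 ∨ σ = -1) (γ : Fin 2 → ℕ) :
    ∃ C : ℝ, 0 < C ∧ ∀ f : SchwartzMap (EuclideanSpace ℝ (Fin 2)) ℂ, ∀ t : ℝ, t ≠ 0 →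
      ∀ μ ∈ Set.Ioc (0 : ℝ) 1, ∀ ε ∈ Set.Ioc (0 : ℝ) 1,
        eLpNorm (fmult (fun ξ => prop2 σ (t / ε) μ ξ * rieszSym γ ξ) ⇑f) ⊤ volume ≤
          ENNReal.ofReal (C * μ ^ (-(1 : ℝ) / 2) * (ε / |t|)) *
            eLpNorm (fmult (fun ξ => (((1 + μ * ‖ξ‖ ^ 2) ^ 2 : ℝ) : ℂ)) ⇑f) 1 volume := by
  obtain ⟨M, hM⟩ := Th_ang γ
  have hM0 : 0 ≤ M := (norm_nonneg _).trans ((hM 0).b0 0)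
  have h3 : 0 < √(3 : ℝ) := by positivity
  refine ⟨480000 * (M + 1) * √3, by positivity, ?_⟩
  intro f t ht μ hμ ε hε
  obtain ⟨hμ0, hμ1⟩ := hμ
  obtain ⟨hε0, hε1⟩ := hε
  have hsm : 0 < √μ := Real.sqrt_pos.2 hμ0
  have hsa : |σ| = 1 := by rcases hσ with rfl | rfl <;> norm_num
  have hσ0 : σ ≠ 0 := by rintro rfl; simp at hsa
  have ht0 : 0 < |t| := abs_pos.2 ht
  refine main_fourier f hμ0 hμ1 ?_ ?_ ?_
  · unfold prop2 rieszSym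
    simp only [Fin.prod_univ_two]
    fun_prop
  · intro ξ
    rw [norm_mul, prop2, norm_cexp_I_mul, one_mul]
    exact riesz_le γ ξ
  · intro z
    have hk := Kern_bound hM (σ := σ) (τ := t / ε) (μ := μ) (c := √3 / √μ)
      (mul_ne_zero hσ0 (div_ne_zero ht hε0.ne')) (by positivity) hμ0
      (by rw [div_pow, Real.sq_sqrt (by norm_num), Real.sq_sqrt hμ0.le]; field_simp) z
    refine hk.trans ?_
    rw [abs_mul, hsa, one_mul, abs_div, abs_of_pos hε0, neg_div, Real.rpow_neg hμ0.le, ← Real.sqrt_eq_rpow]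
    calc 480000 * M * (√3 / √μ) / (|t| / ε) = 480000 * M * √3 * (√μ)⁻¹ * (ε / |t|) := by field_simp
      _ ≤ _ := by gcongr; linarith
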